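/- arXiv:1112.0819 — 2 statements merged into one kernel-verified Lean document; each statement's English description precedes it below -/
import Mathlib

section
/- Let M be a partial order. The relation ≤*_M is reflexive and transitive on CWT(M) (a quasi-order on CWT(M)). -/
open Set Cardinal

universe u

variable {α : Type u}

section OrderDefs

variable [PartialOrder α]

/-- `η` and `ν` are compatible in `M`: they have a common `≤`-upper bound in `M`. -/
def Compat (M : Set α) (η ν : α) : Prop :=
  ∃ ρ ∈ M, η ≤ ρ ∧ ν ≤ ρ

/-- The set of immediate successors of `ν` inside `B`. -/
def succIn (B : Set α) (ν : α) : Set α :=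
  {ρ ∈ B | ν < ρ ∧ ¬∃ σ ∈ B, ν < σ ∧ σ < ρ}

/-- The set of maximal elements of `B`. -/
def maxIn (B : Set α) : Set α :=
  {η ∈ B | ∀ ν ∈ B, ¬η < ν}

/-- `r` is the root (least element) of `B`. -/
def IsRoot (B : Set α) (r : α) : Prop :=
  r ∈ B ∧ ∀ x ∈ B, r ≤ x

/-- `B` is a countable well-founded subtree of `M`. -/
def CWT (M B : Set α) : Prop :=
  B ⊆ M ∧ B.Countable ∧ (∃ r, IsRoot B r) ∧
  (∀ ν ∈ B, ∀ η ∈ B, ∀ ρ ∈ B, η ≤ ν → ρ ≤ ν → η ≤ ρ ∨ ρ ≤ η) ∧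
  (∀ C, C ⊆ B → IsChain (· ≤ ·) C → C.Finite) ∧
  (∀ ν ∈ B, succIn B ν = ∅ ∨ (succIn B ν).Infinite) ∧
  (∀ η ∈ B, ∀ ν ∈ B, ¬η ≤ ν → ¬ν ≤ η → ¬Compat M η ν) ∧
  (∀ ν ∈ B \ maxIn B, ∀ F : Finset α, (F : Set α) ⊆ M \ {ρ | ρ ≤ ν} →
    {ϱ ∈ succIn B ν | ∀ ρ ∈ F, ¬Compat M ρ ϱ}.Infinite)

/-- `Y` is a front of `B`: a maximal set of pairwise incomparable members of `B`. -/
def IsFront (B Y : Set α) : Prop :=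
  Y ⊆ B ∧ (∀ η ∈ Y, ∀ ν ∈ Y, η ≠ ν → ¬η ≤ ν) ∧
  (∀ ν ∈ B, ∃ η ∈ Y, η ≤ ν ∨ ν ≤ η)

/-- `B'` is an exhaustive subtree of `B`. -/
def sb (M B B' : Set α) : Prop :=
  CWT M B' ∧ B' ⊆ B ∧ (∃ r, IsRoot B r ∧ IsRoot B' r) ∧
  ∀ ν ∈ B', succIn B' ν ⊆ succIn B ν ∧ (succIn B ν \ succIn B' ν).Finite

/-- `B'` is a positive subtree of `B`. -/
def psb (M B B' : Set α) : Prop :=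
  CWT M B' ∧ B' ⊆ B ∧ (∃ r, IsRoot B r ∧ IsRoot B' r) ∧
  ∀ ν ∈ B' \ maxIn B, (succIn B' ν).Infinite ∧ succIn B' ν ⊆ succIn B ν

/-- `Y` is an almost front of `B`: an antichain of `M` whose intersection with some
exhaustive subtree `B'` of `B` is a front of `B'`. -/
def IsAlmostFront (M B Y : Set α) : Prop :=
  Y ⊆ M ∧ (∀ η ∈ Y, ∀ ν ∈ Y, η ≠ ν → ¬η ≤ ν) ∧
  ∃ B', sb M B B' ∧ IsFront B' (Y ∩ B')

/-- The relation `B₁ ≤*_M B₂`. -/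
def leStar (M B₁ B₂ : Set α) : Prop :=
  CWT M B₁ ∧ CWT M B₂ ∧ (∃ r, IsRoot B₁ r ∧ IsRoot B₂ r) ∧
  ∃ B₂', sb M B₂ B₂' ∧ psb M B₁ (B₂' ∩ B₁) ∧
    ∀ Y, IsAlmostFront M (B₂' ∩ B₁) Y → IsAlmostFront M B₂ Y

end OrderDefs

section ChainFinite

variable [PartialOrder α]

theorem exists_maximal_of_chains_finite {S : Set α}
    (h : ∀ C, C ⊆ S → IsChain (· ≤ ·) C → C.Finite) (hS : S.Nonempty) :
    ∃ m ∈ S, ∀ x ∈ S, ¬m < x := by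
  obtain ⟨m, hm⟩ := zorn_le₀ S fun c hc hch => by
    rcases c.eq_empty_or_nonempty with rfl | hne
    · exact ⟨hS.some, hS.some_mem, by simp⟩
    · obtain ⟨b, hb⟩ := (h c hc hch).exists_maximal hne
      refine ⟨b, hc hb.1, fun z hz => ?_⟩
      rcases hch.total hz hb.1 with hzb | hbz
      · exact hzb
      · exact hb.2 hz hbz
  exact ⟨m, hm.1, fun x hx hlt => hlt.not_ge (hm.2 hx hlt.le)⟩

theorem exists_minimal_of_chains_finite {S : Set α}
    (h : ∀ C, C ⊆ S → IsChain (· ≤ ·) C → C.Finite) (hS : S.Nonempty) :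
    ∃ m ∈ S, ∀ x ∈ S, ¬x < m :=
  exists_maximal_of_chains_finite (α := αᵒᵈ) (S := S)
    (fun C hC hch => h C hC hch.symm) hS

end ChainFinite

section Trees

variable [PartialOrder α] {M B B' : Set α}

/-- `B'` is a subset of `B` that is closed downwards in `B`. -/
def InitialIn (B B' : Set α) : Prop :=
  B' ⊆ B ∧ ∀ x ∈ B', ∀ y ∈ B, y ≤ x → y ∈ B'

theorem IsRoot.unique {r s : α} (hr : IsRoot B r) (hs : IsRoot B s) : r = s :=
  le_antisymm (hr.2 s hs.1) (hs.2 r hr.1)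

theorem IsRoot.mono {r : α} (hr : IsRoot B r) (h : B' ⊆ B) (hB' : r ∈ B') : IsRoot B' r :=
  ⟨hB', fun x hx => hr.2 x (h hx)⟩

theorem maxIn_eq_of_le {x y : α} (hx : x ∈ maxIn B) (hy : y ∈ B) (h : x ≤ y) : x = y :=
  h.eq_or_lt.resolve_right (hx.2 y hy)

theorem succIn_eq_empty_of_mem_maxIn {x : α} (hx : x ∈ maxIn B) : succIn B x = ∅ :=
  eq_empty_of_forall_notMem fun y hy => hx.2 y hy.1 hy.2.1

theorem notMem_maxIn_of_lt {x y : α} (hy : y ∈ B) (h : x < y) : x ∉ maxIn B :=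
  fun hx => hx.2 y hy h

/-- An immediate successor of `x` lies below every comparable element above `x`. -/
theorem le_of_mem_succIn {x s y : α} (hs : s ∈ succIn B x) (hy : y ∈ B) (hxy : x < y)
    (h : s ≤ y ∨ y ≤ s) : s ≤ y := by
  rcases h with h | h
  · exact h
  · rcases h.eq_or_lt with rfl | h
    · exact le_rfl
    · exact absurd ⟨y, hy, hxy, h⟩ hs.2.2

namespace CWT

theorem le_total_of_le (hB : CWT M B) {x y z : α} (hx : x ∈ B) (hy : y ∈ B) (hz : z ∈ B)
    (hyx : y ≤ x) (hzx : z ≤ x) : y ≤ z ∨ z ≤ y :=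
  hB.2.2.2.1 x hx y hy z hz hyx hzx

theorem chain_finite (hB : CWT M B) (C : Set α) (hC : C ⊆ B) (h : IsChain (· ≤ ·) C) :
    C.Finite :=
  hB.2.2.2.2.1 C hC h

theorem infinite_succIn (hB : CWT M B) {x : α} (hx : x ∈ B) (hmax : x ∉ maxIn B)
    (F : Finset α) (hF : (F : Set α) ⊆ M \ {ρ | ρ ≤ x}) :
    {ϱ ∈ succIn B x | ∀ ρ ∈ F, ¬Compat M ρ ϱ}.Infinite :=
  hB.2.2.2.2.2.2.2 x ⟨hx, hmax⟩ F hF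

theorem exists_max (hB : CWT M B) {S : Set α} (hSB : S ⊆ B) (hS : S.Nonempty) :
    ∃ m ∈ S, ∀ x ∈ S, ¬m < x :=
  exists_maximal_of_chains_finite (fun C hC => hB.chain_finite C (hC.trans hSB)) hS

theorem exists_min (hB : CWT M B) {S : Set α} (hSB : S ⊆ B) (hS : S.Nonempty) :
    ∃ m ∈ S, ∀ x ∈ S, ¬x < m :=
  exists_minimal_of_chains_finite (fun C hC => hB.chain_finite C (hC.trans hSB)) hS

/-- Every element of a subset `S` lies below an element of `maxIn S`. -/
theorem exists_maxIn_ge (hB : CWT M B) {S : Set α} (hSB : S ⊆ B) {x : α} (hx : x ∈ S) :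
    ∃ m ∈ maxIn S, x ≤ m := by
  obtain ⟨m, ⟨hmS, hxm⟩, hm⟩ := hB.exists_max (S := {y ∈ S | x ≤ y})
    (fun y hy => hSB hy.1) ⟨x, hx, le_rfl⟩
  exact ⟨m, ⟨hmS, fun y hy hlt => hm y ⟨hy, hxm.trans hlt.le⟩ hlt⟩, hxm⟩

theorem exists_succIn_le (hB : CWT M B) {S : Set α} (hSB : S ⊆ B) {x y : α} (hy : y ∈ S)
    (hxy : x < y) : ∃ s ∈ succIn S x, s ≤ y := by
  obtain ⟨m, ⟨hmS, hxm, hmy⟩, hm⟩ := hB.exists_min (S := {z ∈ S | x < z ∧ z ≤ y})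
    (fun z hz => hSB hz.1) ⟨y, hy, hxy, le_rfl⟩
  exact ⟨m, ⟨hmS, hxm, fun ⟨z, hz, hxz, hzm⟩ => hm z ⟨hz, hxz, hzm.le.trans hmy⟩ hzm⟩, hmy⟩

theorem exists_greatest_le (hB : CWT M B) {S : Set α} (hSB : S ⊆ B) {x z : α} (hx : x ∈ B)
    (hz : z ∈ S) (hzx : z ≤ x) : ∃ m ∈ S, m ≤ x ∧ ∀ y ∈ S, y ≤ x → y ≤ m := by
  obtain ⟨m, ⟨hmS, hmx⟩, hm⟩ := hB.exists_max (S := {y ∈ S | y ≤ x})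
    (fun y hy => hSB hy.1) ⟨z, hz, hzx⟩
  refine ⟨m, hmS, hmx, fun y hy hyx => ?_⟩
  rcases hB.le_total_of_le hx (hSB hy) (hSB hmS) hyx hmx with h | h
  · exact h
  · exact (h.eq_or_lt.resolve_right (hm y ⟨hy, hyx⟩)).ge

theorem finite_le (hB : CWT M B) {x : α} (hx : x ∈ B) : {y ∈ B | y ≤ x}.Finite :=
  hB.chain_finite _ (fun _ hy => hy.1) fun _ hy _ hz _ =>
    hB.le_total_of_le hx hy.1 hz.1 hy.2 hz.2

theorem infinite_succIn_of_notMem_maxIn (hB : CWT M B) {x : α} (hx : x ∈ B)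
    (hmax : x ∉ maxIn B) : (succIn B x).Infinite :=
  (hB.infinite_succIn hx hmax ∅ (by simp)).mono fun _ h => h.1

end CWT

theorem notMem_maxIn_of_infinite {x : α} (h : (succIn B x).Infinite) : x ∉ maxIn B := by
  obtain ⟨y, hy⟩ := h.nonempty
  exact notMem_maxIn_of_lt hy.1 hy.2.1

theorem InitialIn.succIn_eq (h : InitialIn B B') (x : α) :
    succIn B' x = succIn B x ∩ B' := by
  ext y
  constructor
  · rintro ⟨hy, hxy, hno⟩
    exact ⟨⟨h.1 hy, hxy, fun ⟨z, hz, hxz, hzy⟩ => hno ⟨z, h.2 y hy z hz hzy.le, hxz, hzy⟩⟩, hy⟩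
  · rintro ⟨⟨-, hxy, hno⟩, hy⟩
    exact ⟨hy, hxy, fun ⟨z, hz, hxz, hzy⟩ => hno ⟨z, h.1 hz, hxz, hzy⟩⟩

theorem initialIn_of_succIn_subset (hB : CWT M B) (hsub : B' ⊆ B)
    {r : α} (hr : IsRoot B r) (hr' : r ∈ B')
    (hsucc : ∀ x ∈ B' \ maxIn B, succIn B' x ⊆ succIn B x) : InitialIn B B' := by
  refine ⟨hsub, fun x hx y hy hyx => ?_⟩
  obtain ⟨m, hmB, hmy, hm⟩ := hB.exists_greatest_le hsub hy hr' (hr.2 y hy)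
  rcases hmy.eq_or_lt with rfl | hlt
  · exact hmB
  obtain ⟨s, hs, hsx⟩ := hB.exists_succIn_le hsub hx (hlt.trans_le hyx)
  have hs' := hsucc m ⟨hmB, notMem_maxIn_of_lt hy hlt⟩ hs
  have hsy := le_of_mem_succIn hs' hy hlt (hB.le_total_of_le (hsub hx) hs'.1 hy hsx hyx)
  exact absurd hs.2.1 (hm s hs.1 hsy).not_gt

theorem CWT.of_initialIn (hB : CWT M B) (h : InitialIn B B') {r : α} (hr : IsRoot B r)
    (hr' : r ∈ B')
    (hinf : ∀ x ∈ B' \ maxIn B, ∀ F : Finset α, (F : Set α) ⊆ M \ {ρ | ρ ≤ x} →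
      {ϱ ∈ succIn B x ∩ B' | ∀ ρ ∈ F, ¬Compat M ρ ϱ}.Infinite) : CWT M B' := by
  refine ⟨h.1.trans hB.1, hB.2.1.mono h.1, ⟨r, hr.mono h.1 hr'⟩,
    fun x hx y hy z hz => hB.le_total_of_le (h.1 hx) (h.1 hy) (h.1 hz),
    fun C hC => hB.chain_finite C (hC.trans h.1), fun x hx => ?_,
    fun x hx y hy => hB.2.2.2.2.2.2.1 x (h.1 hx) y (h.1 hy), fun x hx F hF => ?_⟩
  · rw [h.succIn_eq]
    by_cases hmax : x ∈ maxIn B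
    · left
      rw [succIn_eq_empty_of_mem_maxIn hmax, empty_inter]
    · right
      exact (hinf x ⟨hx, hmax⟩ ∅ (by simp)).mono fun _ h => h.1
  · rw [h.succIn_eq]
    exact hinf x ⟨hx.1, fun hmax => hx.2 ⟨hx.1, fun y hy => hmax.2 y (h.1 hy)⟩⟩ F hF

theorem sb_of_initialIn (hB : CWT M B) (h : InitialIn B B') {r : α} (hr : IsRoot B r)
    (hr' : r ∈ B') (hfin : ∀ x ∈ B', (succIn B x \ B').Finite) : sb M B B' := by
  refine ⟨hB.of_initialIn h hr hr' fun x hx F hF => ?_, h.1, ⟨r, hr, hr.mono h.1 hr'⟩,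
    fun x hx => ?_⟩
  · refine ((hB.infinite_succIn (h.1 hx.1) hx.2 F hF).sdiff (hfin x hx.1)).mono ?_
    rintro y ⟨⟨hy, hyF⟩, hn⟩
    exact ⟨⟨hy, by_contra fun hyB => hn ⟨hy, hyB⟩⟩, hyF⟩
  · rw [h.succIn_eq, sdiff_self_inter]
    exact ⟨inter_subset_left, hfin x hx⟩

namespace sb

theorem mem_root (h : sb M B B') {r : α} (hr : IsRoot B r) : r ∈ B' := by
  obtain ⟨s, hs, hs'⟩ := h.2.2.1
  exact hr.unique hs ▸ hs'.1

theorem initialIn (hB : CWT M B) (h : sb M B B') : InitialIn B B' := by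
  obtain ⟨r, hr, hr'⟩ := h.2.2.1
  exact initialIn_of_succIn_subset hB h.2.1 hr hr'.1 fun x hx => (h.2.2.2 x hx.1).1

theorem finite_diff (h : sb M B B') {x : α} (hx : x ∈ B') : (succIn B x \ B').Finite :=
  (h.2.2.2 x hx).2.subset fun _ hy => ⟨hy.1, fun hy' => hy.2 hy'.1⟩

theorem maxIn_subset (hB : CWT M B) (h : sb M B B') : maxIn B' ⊆ maxIn B := by
  intro x hx
  by_contra hmax
  have hinf := (hB.infinite_succIn_of_notMem_maxIn (h.2.1 hx.1) hmax).sdiff (h.finite_diff hx.1)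
  obtain ⟨y, hy, hn⟩ := hinf.nonempty
  exact hx.2 y (by_contra fun hyB => hn ⟨hy, hyB⟩) hy.2.1

theorem refl (hB : CWT M B) : sb M B B := by
  obtain ⟨r, hr⟩ := hB.2.2.1
  exact ⟨hB, Subset.rfl, ⟨r, hr, hr⟩, fun x _ => ⟨Subset.rfl, by simp⟩⟩

end sb

namespace psb

theorem mem_root (h : psb M B B') {r : α} (hr : IsRoot B r) : r ∈ B' := by
  obtain ⟨s, hs, hs'⟩ := h.2.2.1
  exact hr.unique hs ▸ hs'.1

theorem initialIn (hB : CWT M B) (h : psb M B B') : InitialIn B B' := by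
  obtain ⟨r, hr, hr'⟩ := h.2.2.1
  exact initialIn_of_succIn_subset hB h.2.1 hr hr'.1 fun x hx => (h.2.2.2 x hx).2

theorem maxIn_subset (h : psb M B B') : maxIn B' ⊆ maxIn B := fun x hx =>
  by_contra fun hmax => notMem_maxIn_of_infinite (h.2.2.2 x ⟨hx.1, hmax⟩).1 hx

theorem refl (hB : CWT M B) : psb M B B := by
  obtain ⟨r, hr⟩ := hB.2.2.1
  exact ⟨hB, Subset.rfl, ⟨r, hr, hr⟩, fun x hx =>
    ⟨hB.infinite_succIn_of_notMem_maxIn hx.1 hx.2, Subset.rfl⟩⟩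

end psb

/-- A front restricts to a front of an initial subtree all of whose maximal elements are
maximal in the big tree. -/
theorem IsFront.inter (hB : CWT M B) {Y Q : Set α} (hY : IsFront B (Y ∩ B))
    (h : InitialIn B Q) (hmax : maxIn Q ⊆ maxIn B) : IsFront Q (Y ∩ Q) := by
  refine ⟨inter_subset_right,
    fun x hx y hy => hY.2.1 x ⟨hx.1, h.1 hx.2⟩ y ⟨hy.1, h.1 hy.2⟩, fun x hx => ?_⟩
  obtain ⟨m, hm, hxm⟩ := hB.exists_maxIn_ge h.1 hx
  obtain ⟨y, hy, hym⟩ := hY.2.2 m (h.1 hm.1)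
  have hym : y ≤ m := hym.elim id fun hmy => (maxIn_eq_of_le (hmax hm) hy.2 hmy).ge
  exact ⟨y, ⟨hy.1, h.2 m hm.1 y hy.2 hym⟩,
    hB.le_total_of_le (h.1 hm.1) hy.2 (h.1 hx) hym hxm⟩

theorem IsFront.isAlmostFront (hB : CWT M B) {Y : Set α} (hY : IsFront B Y) :
    IsAlmostFront M B Y :=
  ⟨hY.1.trans hB.1, hY.2.1, B, sb.refl hB, by rwa [inter_eq_left.2 hY.1]⟩

theorem IsAlmostFront.of_psb (hB : CWT M B) {P Y : Set α} (hP : psb M B P)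
    (hY : IsAlmostFront M B Y) : IsAlmostFront M P Y := by
  obtain ⟨hYM, hanti, B', hB', hfront⟩ := hY
  obtain ⟨r, hr, hrP⟩ := hP.2.2.1
  have hiP := hP.initialIn hB
  have hiB' := hB'.initialIn hB
  have hsb : sb M P (B' ∩ P) := by
    refine sb_of_initialIn hP.1
      ⟨inter_subset_right, fun x hx y hy hyx => ⟨hiB'.2 x hx.1 y (hiP.1 hy) hyx, hy⟩⟩
      hrP ⟨hB'.mem_root hr, hrP.1⟩ fun x hx => (hB'.finite_diff hx.1).subset ?_
    rintro y ⟨hy, hn⟩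
    rw [hiP.succIn_eq] at hy
    exact ⟨hy.1, fun hyB => hn ⟨hyB, hy.2⟩⟩
  refine ⟨hYM, hanti, B' ∩ P, hsb, hfront.inter hB'.1
    ⟨inter_subset_left, fun x hx y hy hyx => ⟨hy, hiP.2 x hx.2 y (hiB'.1 hy) hyx⟩⟩
    fun x hx => ⟨hx.1.1, fun y hy => ?_⟩⟩
  exact (hP.maxIn_subset (hsb.maxIn_subset hP.1 hx)).2 y (hiB'.1 hy)

/-- Replacing the cone above each member of an antichain `S` of nonmaximal elements by the
immediate successors, and keeping all other maximal elements, gives a front. -/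
theorem isFront_succIn_union_maxIn (hB : CWT M B) {S : Set α} (hSB : S ⊆ B \ maxIn B)
    (hS : ∀ x ∈ S, ∀ y ∈ S, x ≤ y → x = y) :
    IsFront B {y ∈ B | (∃ x ∈ S, y ∈ succIn B x) ∨ (y ∈ maxIn B ∧ ∀ x ∈ S, ¬x ≤ y)} := by
  refine ⟨fun y hy => hy.1, ?_, fun z hz => ?_⟩
  · rintro y ⟨hyB, hy⟩ y' ⟨hyB', hy'⟩ hne hle
    have hlt := lt_of_le_of_ne hle hne
    obtain ⟨x, hx, hyx⟩ := hy.resolve_right fun h => h.1.2 y' hyB' hlt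
    rcases hy' with ⟨x', hx', hyx'⟩ | ⟨-, hno⟩
    · have : x = x' := by
        rcases hB.le_total_of_le hyB' (hSB hx).1 (hSB hx').1 (hyx.2.1.trans hlt).le
          hyx'.2.1.le with h | h
        · exact hS x hx x' hx' h
        · exact (hS x' hx' x hx h).symm
      subst this
      exact hyx'.2.2 ⟨y, hyB, hyx.2.1, hlt⟩
    · exact hno x hx (hyx.2.1.trans hlt).le
  · obtain ⟨m, hm, hzm⟩ := hB.exists_maxIn_ge Subset.rfl hz
    by_cases h : ∃ x ∈ S, x ≤ m
    · obtain ⟨x, hx, hxm⟩ := h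
      have hlt : x < m := lt_of_le_of_ne hxm fun h => (hSB hx).2 (h ▸ hm)
      obtain ⟨s, hs, hsm⟩ := hB.exists_succIn_le Subset.rfl hm.1 hlt
      exact ⟨s, ⟨hs.1, .inl ⟨x, hx, hs⟩⟩, hB.le_total_of_le hm.1 hs.1 hz hsm hzm⟩
    · push Not at h
      exact ⟨m, ⟨hm.1, .inr ⟨hm, h⟩⟩, .inr hzm⟩

theorem isFront_union_maxIn (hB : CWT M B) {Y : Set α} (hYB : Y ⊆ B)
    (hY : ∀ x ∈ Y, ∀ y ∈ Y, x ≠ y → ¬x ≤ y) :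
    IsFront B (Y ∪ {x ∈ maxIn B | ∀ y ∈ Y, ¬y ≤ x}) := by
  refine ⟨union_subset hYB fun x hx => hx.1.1, ?_, fun z hz => ?_⟩
  · rintro x (hx | hx) y (hy | hy) hne hle
    · exact hY x hx y hy hne hle
    · exact hy.2 x hx hle
    · exact hne (maxIn_eq_of_le hx.1 (hYB hy) hle)
    · exact hne (maxIn_eq_of_le hx.1 hy.1.1 hle)
  · obtain ⟨m, hm, hzm⟩ := hB.exists_maxIn_ge Subset.rfl hz
    by_cases h : ∃ y ∈ Y, y ≤ m
    · obtain ⟨y, hy, hym⟩ := h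
      exact ⟨y, .inl hy, hB.le_total_of_le hm.1 (hYB hy) hz hym hzm⟩
    · push Not at h
      exact ⟨m, .inr ⟨hm, h⟩, .inr hzm⟩

/-- Inside `G`, the immediate successors of `x` in `T` form a front of the cone above `x`. -/
def SuccFrontAt (T G : Set α) (x : α) : Prop :=
  ∀ ρ ∈ G, x ≤ ρ → ∃ s ∈ succIn T x ∩ G, s ≤ ρ ∨ ρ ≤ s

/-- If every front of `T` is an almost front of `B`, some exhaustive subtree `G` of `B` only
meets elements of `T` at which the successors in `T` locally form an almost front of `B`. -/
theorem exists_sb_forall_succFrontAt {T : Set α} (hT : CWT M T) (hB : CWT M B)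
    (hfront : ∀ Y, IsFront T Y → IsAlmostFront M B Y) :
    ∃ G, sb M B G ∧ (∀ ρ ∈ G, ∃ y ∈ maxIn T, y ≤ ρ ∨ ρ ≤ y) ∧
      ∀ x ∈ T ∩ G, x ∉ maxIn T → ∃ H, sb M B H ∧ x ∈ H ∧ SuccFrontAt T H x := by
  let N : Set α := {x | x ∈ T ∧ x ∈ B ∧ x ∉ maxIn T ∧
    ¬∃ H, sb M B H ∧ x ∈ H ∧ SuccFrontAt T H x}
  let S : Set α := {x ∈ N | ∀ y ∈ N, ¬y < x}
  have hSmin : ∀ x ∈ S, ∀ y ∈ S, x ≤ y → x = y := fun x hx y hy h =>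
    h.eq_or_lt.resolve_right (hy.2 x hx.1)
  obtain ⟨-, -, G, hG, hGf⟩ := hfront _
    (isFront_succIn_union_maxIn hT (S := S) (fun x hx => ⟨hx.1.1, hx.1.2.2.1⟩) hSmin)
  have hGS : ∀ x ∈ S, x ∉ G := by
    refine fun x hx hxG => hx.1.2.2.2 ⟨G, hG, hxG, fun ρ hρ hxρ => ?_⟩
    obtain ⟨y, ⟨⟨hyT, hy⟩, hyG⟩, hyρ⟩ := hGf.2.2 ρ hρ
    have hxy : x ≤ y ∨ y ≤ x := hyρ.elim (fun h => hG.1.le_total_of_le hρ hxG hyG hxρ h)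
      fun h => .inl (hxρ.trans h)
    rcases hy with ⟨x', hx', hyx'⟩ | ⟨hymax, hno⟩
    · have hxx' : x = x' := by
        rcases hxy with hxy | hyx
        · rcases hT.le_total_of_le hyT hx.1.1 hx'.1.1 hxy hyx'.2.1.le with h | h
          · exact hSmin x hx x' hx' h
          · exact (hSmin x' hx' x hx h).symm
        · exact absurd (hyx'.2.1.trans_le hyx) (hx.2 x' hx'.1)
      exact ⟨y, ⟨hxx' ▸ hyx', hyG⟩, hyρ⟩
    · rcases hxy with hxy | hyx
      · exact absurd hxy (hno x hx)
      · exact absurd (maxIn_eq_of_le hymax hx.1.1 hyx ▸ hymax) hx.1.2.2.1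
  have hiG := hG.initialIn hB
  refine ⟨G, hG, fun ρ hρ => ?_, fun x hx hmax => ?_⟩
  · obtain ⟨y, ⟨⟨hyT, hy⟩, hyG⟩, hyρ⟩ := hGf.2.2 ρ hρ
    rcases hy with ⟨x, hx, hyx⟩ | ⟨hymax, -⟩
    · exact absurd (hiG.2 y hyG x hx.1.2.1 hyx.2.1.le) (hGS x hx)
    · exact ⟨y, hymax, hyρ⟩
  · by_contra hbad
    obtain ⟨m, ⟨hmN, hmx⟩, hm⟩ := hT.exists_min (S := {y ∈ N | y ≤ x}) (fun y hy => hy.1.1)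
      ⟨x, ⟨hx.1, hiG.1 hx.2, hmax, hbad⟩, le_rfl⟩
    exact hGS m ⟨hmN, fun y hy hlt => hm y ⟨hy, hlt.le.trans hmx⟩ hlt⟩
      (hiG.2 x hx.2 m hmN.2.1 hmx)

/-- Diagonal intersection of the trees given by `exists_sb_forall_succFrontAt`. -/
theorem exists_sb_succFrontAt {T : Set α} (hT : CWT M T) (hB : CWT M B) {r : α}
    (hrB : IsRoot B r)
    (hfront : ∀ Y, IsFront T Y → IsAlmostFront M B Y) :
    ∃ E, sb M B E ∧ (∀ ρ ∈ E, ∃ y ∈ maxIn T, y ≤ ρ ∨ ρ ≤ y) ∧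
      ∀ x ∈ T ∩ E, x ∉ maxIn T → SuccFrontAt T E x := by
  obtain ⟨G, hG, hGmax, hGood⟩ := exists_sb_forall_succFrontAt hT hB hfront
  have hiG := hG.initialIn hB
  choose! H hH hxH hfr using hGood
  let D : Set α := {x ∈ T ∩ G | x ∉ maxIn T}
  let E : Set α := {ρ ∈ G | ∀ x ∈ D, x ≤ ρ → ρ ∈ H x}
  have hiE : InitialIn B E := ⟨fun ρ hρ => hiG.1 hρ.1, fun ρ hρ y hy hyρ =>
    ⟨hiG.2 ρ hρ.1 y hy hyρ, fun x hx hxy => ((hH x hx.1 hx.2).initialIn hB).2 ρ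
      (hρ.2 x hx (hxy.trans hyρ)) y hy hyρ⟩⟩
  have hrE : r ∈ E := ⟨hG.mem_root hrB, fun x hx _ => (hH x hx.1 hx.2).mem_root hrB⟩
  have hE : sb M B E := by
    refine sb_of_initialIn hB hiE hrB hrE fun ρ hρ => ?_
    have hfin : {x ∈ D | x ≤ ρ}.Finite := (hB.finite_le (hiE.1 hρ)).subset
      fun x hx => ⟨hiG.1 hx.1.1.2, hx.2⟩
    refine ((hG.finite_diff hρ.1).union (hfin.biUnion fun x hx =>
      (hH x hx.1.1 hx.1.2).finite_diff (hρ.2 x hx.1 hx.2))).subset ?_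
    rintro σ ⟨hσ, hσE⟩
    by_cases hσG : σ ∈ G
    · right
      have : ∃ x ∈ D, x ≤ σ ∧ σ ∉ H x := by
        by_contra! h
        exact hσE ⟨hσG, h⟩
      obtain ⟨x, hx, hxσ, hσH⟩ := this
      refine mem_biUnion (x := x) ⟨hx, ?_⟩ ⟨hσ, hσH⟩
      have hne : x ≠ σ := fun h => hσH (h ▸ hxH x hx.1 hx.2)
      rcases hB.le_total_of_le hσ.1 (hiG.1 hx.1.2) (hiE.1 hρ) hxσ hσ.2.1.le with h | h
      · exact h
      · rcases h.eq_or_lt with rfl | h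
        · exact le_rfl
        · exact absurd ⟨x, hiG.1 hx.1.2, h, lt_of_le_of_ne hxσ hne⟩ hσ.2.2
    · exact .inl ⟨hσ, hσG⟩
  refine ⟨E, hE, fun ρ hρ => hGmax ρ hρ.1, fun x hx hmax ρ hρ hxρ => ?_⟩
  have hxD : x ∈ D := ⟨⟨hx.1, hx.2.1⟩, hmax⟩
  obtain ⟨m, hm, hρm⟩ := hB.exists_maxIn_ge hiE.1 hρ
  obtain ⟨s, ⟨hs, hsH⟩, hsm⟩ := hfr x hxD.1 hmax m (hm.1.2 x hxD (hxρ.trans hρm)) (hxρ.trans hρm)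
  have hsB := (hH x hxD.1 hmax).2.1 hsH
  have hsm : s ≤ m := hsm.elim id fun h =>
    (maxIn_eq_of_le (hE.maxIn_subset hB hm) hsB h).ge
  exact ⟨s, ⟨hs, hiE.2 m hm.1 s hsB hsm⟩,
    hB.le_total_of_le (hiE.1 hm.1) hsB (hiE.1 hρ) hsm hρm⟩

theorem SuccFrontAt.infinite {T E : Set α} (hE : CWT M E) {x : α}
    (hx : x ∈ E) (h : SuccFrontAt T E x) (F : Finset α)
    (hF : (F : Set α) ⊆ M \ {ρ | ρ ≤ x}) :
    {s ∈ succIn T x ∩ E | ∀ ρ ∈ F, ¬Compat M ρ s}.Infinite := by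
  classical
  intro hfin
  have hmax : x ∉ maxIn E := by
    obtain ⟨s, hs, -⟩ := h x hx le_rfl
    exact notMem_maxIn_of_lt hs.2 hs.1.2.1
  obtain ⟨ρ, hρ, hρF⟩ := (hE.infinite_succIn hx hmax (F ∪ hfin.toFinset) (by
    intro y hy
    rcases Finset.mem_union.1 (Finset.mem_coe.1 hy) with hy | hy
    · exact hF hy
    · obtain ⟨⟨hs, hsE⟩, -⟩ := hfin.mem_toFinset.1 hy
      exact ⟨hE.1 hsE, hs.2.1.not_ge⟩)).nonempty
  obtain ⟨s, ⟨hs, hsE⟩, hsρ⟩ := h ρ hρ.1 hρ.2.1.le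
  have hle : ρ ≤ s := le_of_mem_succIn hρ hsE hs.2.1 hsρ.symm
  have hsF : ∀ f ∈ F, ¬Compat M f s := fun f hf ⟨m, hm, hfm, hsm⟩ =>
    hρF f (Finset.mem_union_left _ hf) ⟨m, hm, hfm, hle.trans hsm⟩
  exact hρF s (Finset.mem_union_right _ (hfin.mem_toFinset.2 ⟨⟨hs, hsE⟩, hsF⟩))
    ⟨s, hE.1 hsE, le_rfl, hle⟩

/-- Removing from an exhaustive subtree `E` of `B` the cones above the elements of `E ∩ B₁` that
are not in a given exhaustive subtree of `E ∩ B₁` leaves an exhaustive subtree of `B`. -/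
theorem sb_remove_cones {B₁ E W : Set α} (hB : CWT M B) (hE : sb M B E)
    (hA : CWT M (E ∩ B₁)) (hW : sb M (E ∩ B₁) W) {r : α} (hrB : IsRoot B r)
    (hrA : IsRoot (E ∩ B₁) r) : sb M B {ρ ∈ E | ∀ x ∈ (E ∩ B₁) \ W, ¬x ≤ ρ} := by
  have hiE := hE.initialIn hB
  have hiW := hW.initialIn hA
  refine sb_of_initialIn hB ⟨fun ρ hρ => hiE.1 hρ.1, fun ρ hρ y hy hyρ =>
    ⟨hiE.2 ρ hρ.1 y hy hyρ, fun x hx hxy => hρ.2 x hx (hxy.trans hyρ)⟩⟩ hrB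
    ⟨hrA.1.1, fun x hx hxr => hx.2 (le_antisymm hxr (hrA.2 x hx.1) ▸ hW.mem_root hrA)⟩ ?_
  rintro ρ ⟨hρE, hρ⟩
  have hWB : W ⊆ B := fun x hx => hiE.1 (hiW.1 hx).1
  obtain ⟨m, hmW, hmρ, hm⟩ := hB.exists_greatest_le hWB (hiE.1 hρE) (hW.mem_root hrA)
    (hrB.2 ρ (hiE.1 hρE))
  refine ((hE.finite_diff hρE).union (hW.finite_diff hmW)).subset ?_
  rintro σ ⟨hσ, hσn⟩
  by_cases hσE : σ ∈ E
  swap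
  · exact .inl ⟨hσ, hσE⟩
  right
  have key : ∀ x ∈ E, x ≤ σ → x ≤ ρ ∨ x = σ := by
    intro x hx hxσ
    rcases hB.le_total_of_le hσ.1 (hiE.1 hx) (hiE.1 hρE) hxσ hσ.2.1.le with h | h
    · exact .inl h
    · rcases h.eq_or_lt with rfl | h
      · exact .inl le_rfl
      · exact .inr (hxσ.eq_or_lt.resolve_right fun h' => hσ.2.2 ⟨x, hiE.1 hx, h, h'⟩)
  have hσA : σ ∈ (E ∩ B₁) \ W := by
    by_contra hn
    refine hσn ⟨hσE, fun x hx hxσ => ?_⟩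
    rcases key x hx.1.1 hxσ with h | rfl
    · exact hρ x hx h
    · exact hn hx
  obtain ⟨s, hs, hsσ⟩ := hA.exists_succIn_le Subset.rfl hσA.1 (hmρ.trans_lt hσ.2.1)
  rcases key s hs.1.1 hsσ with h | rfl
  · by_cases hsW : s ∈ W
    · exact absurd hs.2.1 (hm s hsW h).not_gt
    · exact absurd h (hρ s ⟨hs.1, hsW⟩)
  · exact ⟨hs, hσA.2⟩

/-- If every front of some positive subtree of `B₁` is an almost front of `B`, then
`B₁ ≤*_M B`. -/
theorem leStar_of_forall_isFront {B₁ T : Set α} (hB₁ : CWT M B₁) (hB : CWT M B) {r : α}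
    (hr₁ : IsRoot B₁ r) (hrB : IsRoot B r) (hT : psb M B₁ T)
    (hfront : ∀ Y, IsFront T Y → IsAlmostFront M B Y) : leStar M B₁ B := by
  have hiT := hT.initialIn hB₁
  obtain ⟨E, hE, hEmax, hEsucc⟩ := exists_sb_succFrontAt hT.1 hB hrB hfront
  have hiE := hE.initialIn hB
  have hET : E ∩ B₁ ⊆ T := by
    rintro x ⟨hxE, hxB₁⟩
    obtain ⟨y, hy, hyx | hxy⟩ := hEmax x hxE
    · exact maxIn_eq_of_le (hT.maxIn_subset hy) hxB₁ hyx ▸ hy.1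
    · exact hiT.2 y hy.1 x hxB₁ hxy
  have hmaxT : ∀ x ∈ E ∩ B₁, x ∉ maxIn B₁ → x ∉ maxIn T := fun x _ h h' =>
    h (hT.maxIn_subset h')
  have hsucc : ∀ x ∈ (E ∩ B₁) \ maxIn B₁, succIn (E ∩ B₁) x ⊆ succIn B₁ x := by
    rintro x ⟨hx, hmax⟩ ρ hρ
    obtain ⟨s, ⟨hs, hsE⟩, hsρ⟩ :=
      hEsucc x ⟨hET hx, hx.1⟩ (hmaxT x hx hmax) ρ hρ.1.1 hρ.2.1.le
    have hρs := le_of_mem_succIn hρ ⟨hsE, hiT.1 hs.1⟩ hs.2.1 hsρ.symm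
    have hsρ' := le_of_mem_succIn hs (hET hρ.1) hρ.2.1 hsρ
    rw [hiT.succIn_eq] at hs
    exact le_antisymm hρs hsρ' ▸ hs.1
  have hrE : r ∈ E ∩ B₁ := ⟨hE.mem_root hrB, hr₁.1⟩
  have hiA := initialIn_of_succIn_subset hB₁ inter_subset_right hr₁ hrE hsucc
  have hA : CWT M (E ∩ B₁) := by
    refine hB₁.of_initialIn hiA hr₁ hrE fun x hx F hF => ?_
    refine ((hEsucc x ⟨hET hx.1, hx.1.1⟩ (hmaxT x hx.1 hx.2)).infinite hE.1 hx.1.1 F hF).mono ?_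
    rintro s ⟨⟨hs, hsE⟩, hsF⟩
    rw [hiT.succIn_eq] at hs
    exact ⟨⟨hs.1, hsE, hs.1.1⟩, hsF⟩
  have hrA : IsRoot (E ∩ B₁) r := hr₁.mono hiA.1 hrE
  have hpsb : psb M B₁ (E ∩ B₁) := by
    refine ⟨hA, hiA.1, ⟨r, hr₁, hrA⟩, fun x hx => ⟨?_, hsucc x hx⟩⟩
    refine ((hEsucc x ⟨hET hx.1, hx.1.1⟩ (hmaxT x hx.1 hx.2)).infinite hE.1 hx.1.1 ∅
      (by simp)).mono ?_
    rintro s ⟨⟨hs, hsE⟩, -⟩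
    rw [hiT.succIn_eq] at hs
    rw [hiA.succIn_eq]
    exact ⟨hs.1, hsE, hs.1.1⟩
  refine ⟨hB₁, hB, ⟨r, hr₁, hrB⟩, E, hE, hpsb, ?_⟩
  rintro Y ⟨hYM, hanti, W, hW, hWf⟩
  have hWT : W ⊆ T := hW.2.1.trans hET
  obtain ⟨-, -, G, hG, hGf⟩ := hfront _ (isFront_union_maxIn hT.1 (Y := Y ∩ W)
    (inter_subset_right.trans hWT) hWf.2.1)
  have hR := sb_remove_cones hB hE hA hW hrB hrA
  have hiR := hR.initialIn hB
  have hiG := hG.initialIn hB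
  set R := {ρ ∈ E | ∀ x ∈ (E ∩ B₁) \ W, ¬x ≤ ρ}
  have hGR : sb M B (G ∩ R) := by
    refine sb_of_initialIn hB ⟨fun x hx => hiG.1 hx.1, fun x hx y hy hyx =>
      ⟨hiG.2 x hx.1 y hy hyx, hiR.2 x hx.2 y hy hyx⟩⟩ hrB
      ⟨hG.mem_root hrB, hR.mem_root hrB⟩ fun x hx => ?_
    rw [sdiff_inter]
    exact (hG.finite_diff hx.1).union (hR.finite_diff hx.2)
  have hGRf := hGf.inter hG.1 (Q := G ∩ R)
    ⟨inter_subset_left, fun x hx y hy hyx => ⟨hy, hiR.2 x hx.2 y (hiG.1 hy) hyx⟩⟩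
    fun x hx => ⟨hx.1.1, fun y hy => (hGR.maxIn_subset hB hx).2 y (hiG.1 hy)⟩
  refine ⟨hYM, hanti, G ∩ R, hGR, inter_subset_right,
    fun x hx y hy => hanti x hx.1 y hy.1, fun ρ hρ => ?_⟩
  obtain ⟨y, ⟨hy, hyGR⟩, hyρ⟩ := hGRf.2.2 ρ hρ
  rcases hy with hy | ⟨hymax, hno⟩
  · exact ⟨y, ⟨hy.1, hyGR⟩, hyρ⟩
  · have hyW : y ∈ W := by
      by_contra hn
      exact hyGR.2.2 y ⟨⟨hyGR.2.1, hiT.1 hymax.1⟩, hn⟩ le_rfl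
    obtain ⟨z, hz, hzy | hyz⟩ := hWf.2.2 y hyW
    · exact absurd hzy (hno z hz)
    · exact absurd (maxIn_eq_of_le hymax (hWT hz.2) hyz).ge (hno z hz)

end Trees

/-- `≤*_M` is reflexive and transitive on `CWT(M)`. -/
theorem leStar_refl_trans [PartialOrder α] (M : Set α) :
    (∀ B, CWT M B → leStar M B B) ∧
    (∀ B₁ B₂ B₃, CWT M B₁ → CWT M B₂ → CWT M B₃ →
      leStar M B₁ B₂ → leStar M B₂ B₃ → leStar M B₁ B₃) := by
  refine ⟨fun B hB => ?_, fun B₁ B₂ B₃ h₁ h₂ h₃ h₁₂ h₂₃ => ?_⟩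
  · obtain ⟨r, hr⟩ := hB.2.2.1
    refine ⟨hB, hB, ⟨r, hr, hr⟩, B, sb.refl hB, ?_⟩
    rw [inter_self]
    exact ⟨psb.refl hB, fun Y hY => hY⟩
  · obtain ⟨-, -, ⟨r, hr₁, hr₂⟩, C, -, hC, hCY⟩ := h₁₂
    obtain ⟨-, -, ⟨s, hs₂, hs₃⟩, D, -, hD, hDY⟩ := h₂₃
    obtain rfl := hr₂.unique hs₂
    exact leStar_of_forall_isFront h₁ h₃ hr₁ hs₃ hC fun Y hY =>
      hDY Y ((hCY Y (hY.isAlmostFront hC.1)).of_psb h₂ hD)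
end

section
/- Assume x ∈ 𝐊_{≤ℵ₀} and B ∈ ℬ_x is ≤_x-maximal. Then there are y ∈ 𝐊_{≤ℵ₀} and B' ∈ ℬ_y such that: (a) x ≤_𝐊 y and M_x = M_y = M; (b) B' is ≤_y-maximal in ℬ_y; (c) if ν ∈ B' \ max(B') and ρ ∈ M \ {σ : σ ≤_M ν}, then for all but finitely many ϱ ∈ suc_{B'}(ν), ρ and ϱ are incompatible in M (equivalently, id_y(ν,B') is the ideal of finite subsets of suc_{B'}(ν)). -/
open Set Cardinal

universe u

variable {α : Type u}

section KDefs

variable (α) [PartialOrder α]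

/-- A member of the class `𝐊`: a system of approximations to a system of ultrafilters. -/
structure KSys where
  /-- the underlying set of the partial order `M_x` (the order is inherited from `α`) -/
  M : Set α
  /-- the root, i.e. the least element, of `M_x` -/
  rt : α
  rt_mem : rt ∈ M
  rt_least : ∀ a ∈ M, rt ≤ a
  /-- the system `⟨𝒜^x_η : η ∈ M_x⟩` -/
  A : α → Set (Set α)
  A_empty : ∀ η, η ∉ M → A η = ∅
  A_cwt : ∀ η ∈ M, ∀ B ∈ A η, CWT M B
  A_root : ∀ η ∈ M, ∀ B ∈ A η, IsRoot B η
  A_singleton : ∀ η ∈ M, {η} ∈ A η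
  /-- the partial order `≤_x` on `ℬ_x = 𝒜^x_{rt} \ {{rt}}` -/
  lex : Set α → Set α → Prop
  lex_mem : ∀ B₁ B₂, lex B₁ B₂ →
    B₁ ∈ A rt \ {({rt} : Set α)} ∧ B₂ ∈ A rt \ {({rt} : Set α)}
  lex_refl : ∀ B ∈ A rt \ {({rt} : Set α)}, lex B B
  lex_trans : ∀ B₁ B₂ B₃, lex B₁ B₂ → lex B₂ B₃ → lex B₁ B₃
  lex_antisymm : ∀ B₁ B₂, lex B₁ B₂ → lex B₂ B₁ → B₁ = B₂
  lex_directed : ∀ B₁ ∈ A rt \ {({rt} : Set α)}, ∀ B₂ ∈ A rt \ {({rt} : Set α)},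
    ∃ B₃ ∈ A rt \ {({rt} : Set α)}, lex B₁ B₃ ∧ lex B₂ B₃
  lex_leStar : ∀ B₁ B₂, lex B₁ B₂ → leStar M B₁ B₂
  A_restrict : ∀ η ∈ M, ∀ B ∈ A η, ∀ ν ∈ B, B ∩ {ρ | ν ≤ ρ} ∈ A ν

variable {α}

namespace KSys

/-- `ℬ_x = 𝒜^x_{rt_x} \ {{rt_x}}`. -/
def Bf (x : KSys α) : Set (Set α) :=
  x.A x.rt \ {({x.rt} : Set α)}

/-- The filter `D^x_Y` on an almost front `Y`. -/
def D (x : KSys α) (Y : Set α) : Set (Set α) :=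
  {Z | Z ⊆ Y ∧ ∃ B ∈ x.Bf, ∃ B', sb x.M B B' ∧ IsAlmostFront x.M B Y ∧ B' ∩ Y ⊆ Z}

/-- The ideal `id_x(ν,B)` on `suc_B(ν)`. -/
def idl (x : KSys α) (ν : α) (B : Set α) : Set (Set α) :=
  {C | C ⊆ succIn B ν ∧ ∃ F : Finset α, (F : Set α) ⊆ x.M \ {ρ | ν ≤ ρ} ∧
    ∀ ϱ ∈ C, ∃ ρ ∈ F, Compat x.M ϱ ρ}

/-- `‖x‖ = |M_x| + Σ {|𝒜^x_η| : η ∈ M_x}`. -/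
noncomputable def norm (x : KSys α) : Cardinal.{u} :=
  Cardinal.mk ↥x.M + Cardinal.sum fun η : ↥x.M => Cardinal.mk ↥(x.A ↑η)

end KSys

/-- The relation `x ≤_𝐊 y`. -/
def KLE (x y : KSys α) : Prop :=
  x.M ⊆ y.M ∧
  (∀ η ∈ x.M, ∀ ν ∈ x.M, (Compat x.M η ν ↔ Compat y.M η ν)) ∧
  (∀ η ∈ x.M, x.A η ⊆ y.A η) ∧
  y.rt = x.rt ∧
  (∀ B₁ ∈ x.Bf, ∀ B₂ ∈ x.Bf, (x.lex B₁ B₂ ↔ y.lex B₁ B₂))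

end KDefs

section TreeLemmas

variable [PartialOrder α] {M B B' : Set α} {r r' ν η ρ σ τ : α}

theorem Compat.mono_right (h : Compat M ρ η) (hσ : σ ≤ η) : Compat M ρ σ := by
  obtain ⟨τ, hτ, h1, h2⟩ := h
  exact ⟨τ, hτ, h1, hσ.trans h2⟩

theorem IsRoot.eq (h : IsRoot B r) (h' : IsRoot B r') : r = r' :=
  le_antisymm (h.2 _ h'.1) (h'.2 _ h.1)

theorem succIn_eq_of_le_of_le (hη : η ∈ succIn B ν) (hρ : ρ ∈ succIn B ν) (h : η ≤ ρ) :
    η = ρ := by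
  by_contra hne
  exact hρ.2.2 ⟨η, hη.1, hη.2.1, lt_of_le_of_ne h hne⟩

theorem exists_lt_of_notMem_maxIn (hσ : σ ∉ maxIn B) (hσB : σ ∈ B) : ∃ τ ∈ B, σ < τ := by
  by_contra h
  push Not at h
  exact hσ ⟨hσB, h⟩

namespace CWT

theorem subset (h : CWT M B) : B ⊆ M := h.1

theorem comparable (h : CWT M B) (hν : ν ∈ B) (hη : η ∈ B) (hρ : ρ ∈ B) (h1 : η ≤ ν)
    (h2 : ρ ≤ ν) : η ≤ ρ ∨ ρ ≤ η := h.2.2.2.1 ν hν η hη ρ hρ h1 h2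

theorem succIn_infinite (h : CWT M B) (hν : ν ∈ B) (hne : (succIn B ν).Nonempty) :
    (succIn B ν).Infinite :=
  (h.2.2.2.2.2.1 ν hν).resolve_left hne.ne_empty

theorem finite_below (h : CWT M B) (hσ : σ ∈ B) : {τ ∈ B | τ ≤ σ}.Finite := by
  refine h.2.2.2.2.1 _ (fun _ hx => hx.1) ?_
  intro a ha b hb _
  exact h.comparable hσ ha.1 hb.1 ha.2 hb.2

theorem exists_le_maxIn (h : CWT M B) (hσ : σ ∈ B) : ∃ τ ∈ maxIn B, σ ≤ τ := by
  obtain ⟨m, hm, hmax⟩ := zorn_le_nonempty₀ B (fun c hc hch y hy => by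
    obtain ⟨u, hu⟩ := (h.2.2.2.2.1 c hc hch).exists_maximal ⟨y, hy⟩
    refine ⟨u, hc hu.1, fun z hz => ?_⟩
    rcases hch.total hz hu.1 with h1 | h1
    · exact h1
    · exact hu.2 hz h1) σ hσ
  exact ⟨m, ⟨hmax.1, fun ν hν hlt => hlt.not_ge (hmax.2 hν hlt.le)⟩, hm⟩

theorem exists_succIn_le_s16 (h : CWT M B) (hσ : σ ∈ B) (hlt : ν < σ) :
    ∃ η ∈ succIn B ν, η ≤ σ := by
  have hfin : {τ ∈ B | ν < τ ∧ τ ≤ σ}.Finite :=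
    (h.finite_below hσ).subset fun _ hx => ⟨hx.1, hx.2.2⟩
  obtain ⟨η, hη⟩ := hfin.exists_minimal ⟨σ, hσ, hlt, le_rfl⟩
  refine ⟨η, ⟨hη.1.1, hη.1.2.1, ?_⟩, hη.1.2.2⟩
  rintro ⟨τ, hτ, h1, h2⟩
  exact h2.not_ge (hη.2 ⟨hτ, h1, h2.le.trans hη.1.2.2⟩ h2.le)

theorem le_of_lt_succIn (h : CWT M B) (hν : ν ∈ B) (hη : η ∈ B) (hρ : ρ ∈ succIn B ν)
    (hlt : η < ρ) : η ≤ ν := by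
  rcases h.comparable hρ.1 hη hν hlt.le hρ.2.1.le with h1 | h1
  · exact h1
  · rcases h1.eq_or_lt with h2 | h2
    · exact h2.ge
    · exact absurd ⟨η, hη, h2, hlt⟩ hρ.2.2

theorem nonmax_succIn_infinite (h : CWT M B) (hν : ν ∈ B) (hν' : ν ∉ maxIn B) :
    (succIn B ν).Infinite := by
  obtain ⟨τ, hτ, hlt⟩ := exists_lt_of_notMem_maxIn hν' hν
  obtain ⟨η, hη, -⟩ := h.exists_succIn_le_s16 hτ hlt
  exact h.succIn_infinite hν ⟨η, hη⟩

theorem nonmax_avoid (h : CWT M B) (hν : ν ∈ B) (hν' : ν ∉ maxIn B) (F : Finset α)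
    (hF : (F : Set α) ⊆ M \ {ρ | ρ ≤ ν}) :
    {ϱ ∈ succIn B ν | ∀ ρ ∈ F, ¬Compat M ρ ϱ}.Infinite :=
  h.2.2.2.2.2.2.2 ν ⟨hν, hν'⟩ F hF

end CWT

/-- `D` contains every element of `B` lying below one of its members. -/
def IsLowerIn (B D : Set α) : Prop :=
  ∀ σ ∈ D, ∀ τ ∈ B, τ ≤ σ → τ ∈ D

theorem IsLowerIn.succIn_eq {D : Set α} (hD : IsLowerIn B D) (hDB : D ⊆ B) :
    succIn D ν = succIn B ν ∩ D := by
  ext ϱ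
  constructor
  · rintro ⟨h1, h2, h3⟩
    refine ⟨⟨hDB h1, h2, ?_⟩, h1⟩
    rintro ⟨σ, hσ, h4, h5⟩
    exact h3 ⟨σ, hD ϱ h1 σ hσ h5.le, h4, h5⟩
  · rintro ⟨⟨h1, h2, h3⟩, h4⟩
    refine ⟨h4, h2, ?_⟩
    rintro ⟨σ, hσ, h5⟩
    exact h3 ⟨σ, hDB hσ, h5⟩

theorem isLowerIn_of_succIn_subset (hB : CWT M B) (hB' : CWT M B') (hsub : B' ⊆ B)
    (hr : IsRoot B r) (hr' : r ∈ B')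
    (hs : ∀ ν ∈ B' \ maxIn B, succIn B' ν ⊆ succIn B ν) : IsLowerIn B B' := by
  intro σ hσ τ hτ hle
  have hfin : {μ ∈ B' | μ ≤ τ}.Finite :=
    (hB.finite_below hτ).subset fun _ hx => ⟨hsub hx.1, hx.2⟩
  obtain ⟨μ, hμ⟩ := hfin.exists_maximal ⟨r, hr', hr.2 τ hτ⟩
  rcases hμ.1.2.eq_or_lt with h1 | h1
  · exact h1 ▸ hμ.1.1
  obtain ⟨η, hη, hησ⟩ := hB'.exists_succIn_le_s16 hσ (h1.trans_le hle)
  have hηB := hs μ ⟨hμ.1.1, fun h => h.2 τ hτ h1⟩ hη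
  rcases hB.comparable (hsub hσ) hηB.1 hτ hησ hle with h2 | h2
  · exact absurd (hμ.2 ⟨hη.1, h2⟩ hη.2.1.le) hη.2.1.not_ge
  · rcases h2.eq_or_lt with h3 | h3
    · exact h3 ▸ hη.1
    · exact absurd ⟨τ, hτ, h1, h3⟩ hηB.2.2

theorem sb.isLowerIn (hB : CWT M B) (h : sb M B B') : IsLowerIn B B' := by
  obtain ⟨h1, h2, ⟨r, hr, hr'⟩, h3⟩ := h
  exact isLowerIn_of_succIn_subset hB h1 h2 hr hr'.1 fun ν hν => (h3 ν hν.1).1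

theorem psb.isLowerIn (hB : CWT M B) (h : psb M B B') : IsLowerIn B B' := by
  obtain ⟨h1, h2, ⟨r, hr, hr'⟩, h3⟩ := h
  exact isLowerIn_of_succIn_subset hB h1 h2 hr hr'.1 fun ν hν => (h3 ν hν).2

/-- A maximal element of a positive subtree is maximal in the whole tree. -/
theorem psb.maxIn_subset_s16 (h : psb M B B') : maxIn B' ⊆ maxIn B := by
  intro σ hσ
  by_contra hn
  obtain ⟨τ, hτ⟩ := (h.2.2.2 σ ⟨hσ.1, hn⟩).1.nonempty
  exact hσ.2 τ hτ.1 hτ.2.1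

theorem sb.finite_diff_s16 (h : sb M B B') (hν : ν ∈ B') :
    (succIn B ν \ B').Finite := by
  refine (h.2.2.2 ν hν).2.subset ?_
  rintro ϱ ⟨h1, h2⟩
  exact ⟨h1, fun h3 => h2 h3.1⟩

theorem sb.maxIn_subset_s16 (hB : CWT M B) (h : sb M B B') : maxIn B' ⊆ maxIn B := by
  intro σ hσ
  by_contra hn
  have hinf := hB.nonmax_succIn_infinite (h.2.1 hσ.1) hn
  obtain ⟨τ, hτ, hτ'⟩ := (hinf.sdiff (h.finite_diff_s16 hσ.1)).nonempty
  have hτB' : τ ∈ B' := by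
    by_contra hh
    exact hτ' ⟨hτ, hh⟩
  exact hσ.2 τ hτB' hτ.2.1

/-- A lower subset of a tree in which every node that is not maximal in the tree keeps enough
successors is again a tree. -/
theorem CWT.of_isLowerIn {D : Set α} (hB : CWT M B) (hDB : D ⊆ B) (hr : IsRoot B r)
    (hrD : r ∈ D) (hD : IsLowerIn B D)
    (hs : ∀ ν ∈ D, ν ∉ maxIn B → ∀ F : Finset α, (F : Set α) ⊆ M \ {ρ | ρ ≤ ν} →
      {ϱ ∈ succIn B ν ∩ D | ∀ ρ ∈ F, ¬Compat M ρ ϱ}.Infinite) : CWT M D := by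
  refine ⟨hDB.trans hB.1, hB.2.1.mono hDB, ⟨r, hrD, fun x hx => hr.2 x (hDB hx)⟩,
    fun ν hν η hη ρ hρ => hB.2.2.2.1 ν (hDB hν) η (hDB hη) ρ (hDB hρ),
    fun C hC => hB.2.2.2.2.1 C (hC.trans hDB), ?_,
    fun η hη ν hν => hB.2.2.2.2.2.2.1 η (hDB hη) ν (hDB hν), ?_⟩
  · intro ν hν
    rw [hD.succIn_eq hDB]
    by_cases hm : ν ∈ maxIn B
    · left
      rw [Set.eq_empty_iff_forall_notMem]
      rintro ϱ ⟨h1, -⟩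
      exact hm.2 ϱ h1.1 h1.2.1
    · right
      exact (hs ν hν hm ∅ (by simp)).mono fun _ hx => hx.1
  · rintro ν ⟨hν, hm⟩ F hF
    rw [hD.succIn_eq hDB]
    exact hs ν hν (fun h => hm ⟨hν, fun τ hτ => h.2 τ (hDB hτ)⟩) F hF

theorem psb_of_isLowerIn {D : Set α} (hB : CWT M B) (hDB : D ⊆ B) (hr : IsRoot B r)
    (hrD : r ∈ D) (hD : IsLowerIn B D)
    (hs : ∀ ν ∈ D, ν ∉ maxIn B → ∀ F : Finset α, (F : Set α) ⊆ M \ {ρ | ρ ≤ ν} →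
      {ϱ ∈ succIn B ν ∩ D | ∀ ρ ∈ F, ¬Compat M ρ ϱ}.Infinite) : psb M B D := by
  refine ⟨hB.of_isLowerIn hDB hr hrD hD hs, hDB,
    ⟨r, hr, hrD, fun x hx => hr.2 x (hDB hx)⟩, ?_⟩
  rintro ν ⟨hν, hm⟩
  rw [hD.succIn_eq hDB]
  exact ⟨(hs ν hν hm ∅ (by simp)).mono fun _ hx => hx.1, inter_subset_left⟩

theorem sb_of_isLowerIn {D : Set α} (hB : CWT M B) (hDB : D ⊆ B) (hr : IsRoot B r)
    (hrD : r ∈ D) (hD : IsLowerIn B D) (hs : ∀ ν ∈ D, (succIn B ν \ D).Finite) :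
    sb M B D := by
  refine ⟨hB.of_isLowerIn hDB hr hrD hD ?_, hDB,
    ⟨r, hr, hrD, fun x hx => hr.2 x (hDB hx)⟩, ?_⟩
  · intro ν hν hm F hF
    refine ((hB.nonmax_avoid (hDB hν) hm F hF).sdiff (hs ν hν)).mono ?_
    rintro ϱ ⟨⟨h1, h2⟩, h3⟩
    refine ⟨⟨h1, ?_⟩, h2⟩
    by_contra h4
    exact h3 ⟨h1, h4⟩
  · intro ν hν
    rw [hD.succIn_eq hDB]
    refine ⟨inter_subset_left, ?_⟩
    rw [Set.sdiff_self_inter]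
    exact hs ν hν

theorem sb.trans {D : Set α} (h : sb M B D) (h' : sb M D B') : sb M B B' := by
  obtain ⟨-, hsub, ⟨r, hr, hrD⟩, hs⟩ := h
  obtain ⟨hB', hsub', ⟨r', hr', hrB'⟩, hs'⟩ := h'
  refine ⟨hB', hsub'.trans hsub, ⟨r, hr, hrD.eq hr' ▸ hrB'⟩, fun ν hν => ?_⟩
  obtain ⟨h1, h2⟩ := hs ν (hsub' hν)
  obtain ⟨h3, h4⟩ := hs' ν hν
  refine ⟨h3.trans h1, (h2.union h4).subset ?_⟩
  rintro ϱ ⟨h5, h6⟩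
  by_cases h7 : ϱ ∈ succIn D ν
  · exact Or.inr ⟨h7, h6⟩
  · exact Or.inl ⟨h5, h7⟩

theorem IsAlmostFront.of_sb {Y : Set α} (h : sb M B B') (hY : IsAlmostFront M B' Y) :
    IsAlmostFront M B Y := by
  obtain ⟨hYM, hanti, S, hS, hfront⟩ := hY
  exact ⟨hYM, hanti, S, h.trans hS, hfront⟩

theorem sb_refl (hB : CWT M B) : sb M B B := by
  obtain ⟨r, hr⟩ := hB.2.2.1
  exact sb_of_isLowerIn hB subset_rfl hr hr.1 (fun _ _ _ h _ => h) fun ν _ =>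
    Set.finite_empty.subset fun _ hx => hx.2 hx.1.1

theorem psb_refl (hB : CWT M B) : psb M B B := by
  obtain ⟨r, hr⟩ := hB.2.2.1
  exact ⟨hB, subset_rfl, ⟨r, hr, hr⟩, fun ν hν =>
    ⟨hB.nonmax_succIn_infinite hν.1 hν.2, subset_rfl⟩⟩

theorem leStar_refl (hB : CWT M B) : leStar M B B := by
  obtain ⟨r, hr⟩ := hB.2.2.1
  refine ⟨hB, hB, ⟨r, hr, hr⟩, B, sb_refl hB, ?_⟩
  rw [inter_self]
  exact ⟨psb_refl hB, fun _ h => h⟩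

/-- The part of a tree above one of its nodes is a tree. -/
theorem CWT.cone (hB : CWT M B) (hη : η ∈ B) : CWT M (B ∩ {ρ | η ≤ ρ}) := by
  have hsucc : ∀ ν, η ≤ ν → succIn (B ∩ {ρ | η ≤ ρ}) ν = succIn B ν := by
    intro ν hν
    ext ϱ
    constructor
    · rintro ⟨h1, h2, h3⟩
      exact ⟨h1.1, h2, fun ⟨σ, h4, h5, h6⟩ => h3 ⟨σ, ⟨h4, hν.trans h5.le⟩, h5, h6⟩⟩
    · rintro ⟨h1, h2, h3⟩
      exact ⟨⟨h1, hν.trans h2.le⟩, h2, fun ⟨σ, h4, h5, h6⟩ => h3 ⟨σ, h4.1, h5, h6⟩⟩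
  have hsub : B ∩ {ρ | η ≤ ρ} ⊆ B := inter_subset_left
  refine ⟨hsub.trans hB.1, hB.2.1.mono hsub, ⟨η, ⟨hη, le_rfl⟩, fun x hx => hx.2⟩,
    fun a ha b hb c hc => hB.2.2.2.1 a (hsub ha) b (hsub hb) c (hsub hc),
    fun C hC => hB.2.2.2.2.1 C (hC.trans hsub), ?_,
    fun a ha b hb => hB.2.2.2.2.2.2.1 a (hsub ha) b (hsub hb), ?_⟩
  · intro ν hν
    rw [hsucc ν hν.2]
    exact hB.2.2.2.2.2.1 ν hν.1
  · rintro ν ⟨hν, hm⟩ F hF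
    rw [hsucc ν hν.2]
    exact hB.nonmax_avoid hν.1 (fun h => hm ⟨hν, fun τ hτ => h.2 τ hτ.1⟩) F hF

end TreeLemmas

section Transfer

variable [PartialOrder α] {M B B₁ T D D' : Set α} {r ν σ : α}

/-- The successors of `ν` in `T` form a front, above `ν`, of some exhaustive subtree of `B`
containing `ν`. -/
def SuccAlmostFront (M B T : Set α) (ν : α) : Prop :=
  ∃ E, sb M B E ∧ ν ∈ E ∧ ∀ σ ∈ maxIn E, ν < σ → ∃ η ∈ succIn T ν, η ≤ σ

/-- If almost fronts of `T` are almost fronts of `B`, then some exhaustive subtree of `B` meets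
`T` only in nodes whose successors in `T` form an almost front of `B`. -/
theorem exists_sb_succAlmostFront (hB : CWT M B) (hT : CWT M T) (hTB : T ⊆ B)
    (hfront : ∀ Y, IsAlmostFront M T Y → IsAlmostFront M B Y) :
    ∃ E, sb M B E ∧ ∀ ν ∈ T, ν ∉ maxIn T → ν ∈ E → SuccAlmostFront M B T ν := by
  set N : Set α := {ν ∈ T | ν ∉ maxIn T ∧ ¬SuccAlmostFront M B T ν} with hN
  set N₀ : Set α := {ν ∈ N | ∀ μ ∈ N, ¬μ < ν} with hN₀
  have hN₀T : ∀ ν ∈ N₀, ν ∈ T := fun ν hν => hν.1.1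
  have huniq : ∀ ν ∈ N₀, ∀ ν' ∈ N₀, ∀ σ ∈ B, ν ≤ σ → ν' ≤ σ → ν = ν' := by
    intro ν hν ν' hν' σ hσ h1 h2
    rcases hB.comparable hσ (hTB (hN₀T ν hν)) (hTB (hN₀T ν' hν')) h1 h2 with h | h
    · by_contra hne
      exact hν'.2 ν hν.1 (lt_of_le_of_ne h hne)
    · by_contra hne
      exact hν.2 ν' hν'.1 (lt_of_le_of_ne h (Ne.symm hne))
  set Y : Set α := {η | (∃ ν ∈ N₀, η ∈ succIn T ν) ∨ (η ∈ maxIn T ∧ ∀ ν ∈ N₀, ¬ν ≤ η)} with hY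
  have hYT : Y ⊆ T := by
    rintro η (⟨ν, -, h⟩ | h)
    · exact h.1
    · exact h.1.1
  have hanti : ∀ η ∈ Y, ∀ ν ∈ Y, η ≠ ν → ¬η ≤ ν := by
    rintro η (⟨μ, hμ, h1⟩ | h1) ν (⟨μ', hμ', h2⟩ | h2) hne hle
    · obtain rfl := huniq μ hμ μ' hμ' ν (hTB h2.1) (h1.2.1.le.trans hle) h2.2.1.le
      exact hne (succIn_eq_of_le_of_le h1 h2 hle)
    · exact h2.2 μ hμ (h1.2.1.le.trans hle)
    · exact h1.1.2 ν h2.1 (lt_of_le_of_ne hle hne)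
    · exact h1.1.2 ν h2.1.1 (lt_of_le_of_ne hle hne)
  have hYfront : IsAlmostFront M T Y := by
    refine ⟨hYT.trans hT.subset, hanti, T, sb_refl hT, inter_subset_right,
      fun η hη ν hν => hanti η hη.1 ν hν.1, ?_⟩
    intro σ hσ
    obtain ⟨τ, hτ, hστ⟩ := hT.exists_le_maxIn hσ
    by_cases h : ∃ ν ∈ N₀, ν ≤ τ
    · obtain ⟨ν, hν, hle⟩ := h
      have hlt : ν < τ := lt_of_le_of_ne hle fun h => hν.1.2.1 (h ▸ hτ)
      obtain ⟨η, hη, hητ⟩ := hT.exists_succIn_le_s16 hτ.1 hlt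
      exact ⟨η, ⟨Or.inl ⟨ν, hν, hη⟩, hη.1⟩, hT.comparable hτ.1 hη.1 hσ hητ hστ⟩
    · push Not at h
      exact ⟨τ, ⟨Or.inr ⟨hτ, h⟩, hτ.1⟩, Or.inr hστ⟩
  obtain ⟨-, -, E, hE, hEfront⟩ := hfront Y hYfront
  refine ⟨E, hE, fun ν hνT hνm hνE => ?_⟩
  by_contra hbad
  obtain ⟨ν₀, hν₀⟩ := ((hT.finite_below hνT).subset
    (t := {μ ∈ N | μ ≤ ν}) fun x hx => ⟨hx.1.1, hx.2⟩).exists_minimal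
      ⟨ν, ⟨hνT, hνm, hbad⟩, le_rfl⟩
  have hmem : ν₀ ∈ N₀ :=
    ⟨hν₀.1.1, fun μ hμ hlt => hlt.not_ge (hν₀.2 ⟨hμ, hlt.le.trans hν₀.1.2⟩ hlt.le)⟩
  refine hmem.1.2.2 ⟨E, hE, hE.isLowerIn hB ν hνE ν₀ (hTB hmem.1.1) hν₀.1.2, ?_⟩
  intro σ hσ hlt
  have hσB := hE.2.1 hσ.1
  obtain ⟨η, ⟨hηY, hηE⟩, hη⟩ := hEfront.2.2 σ hσ.1
  have hησ : η ≤ σ := by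
    rcases hη with h | h
    · exact h
    · rcases h.eq_or_lt with h | h
      · exact h.ge
      · exact absurd h (hσ.2 η hηE)
  rcases hηY with ⟨μ, hμ, hημ⟩ | ⟨hηm, hηN⟩
  · obtain rfl := huniq μ hμ ν₀ hmem σ hσB (hημ.2.1.le.trans hησ) hlt.le
    exact ⟨η, hημ, hησ⟩
  · rcases hB.comparable hσB (hTB hηm.1) (hTB hmem.1.1) hησ hlt.le with h | h
    · rcases h.eq_or_lt with h | h
      · exact absurd h.ge (hηN ν₀ hmem)
      · exact absurd h (hηm.2 ν₀ hmem.1.1)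
    · exact absurd h (hηN ν₀ hmem)

/-- A positive subtree `D` of `B` has an exhaustive subtree inside a given exhaustive subtree of
`B` in which the successors in `T` of each node form a front above that node. -/
theorem exists_sb_succIn_le (hB : CWT M B) (hT : CWT M T) (hTB : T ⊆ B)
    (hfront : ∀ Y, IsAlmostFront M T Y → IsAlmostFront M B Y)
    {B₂ : Set α} (hB₂ : sb M B B₂) (hD : psb M B D) :
    ∃ D', sb M D D' ∧ D' ⊆ B₂ ∧ ∀ ν ∈ T, ν ∉ maxIn T → ν ∈ D' →
      ∀ σ ∈ maxIn D', ν < σ → ∃ η ∈ succIn T ν, η ≤ σ := by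
  obtain ⟨E, hE, hgood⟩ := exists_sb_succAlmostFront hB hT hTB hfront
  choose! G hGsb hGmem hG using hgood
  obtain ⟨r, hr⟩ := hB.2.2.1
  have hrsb : ∀ S, sb M B S → r ∈ S := by
    rintro S ⟨-, -, ⟨r', h1, h2⟩, -⟩
    exact hr.eq h1 ▸ h2.1
  have hrD : IsRoot D r := by
    obtain ⟨-, -, ⟨r', h1, h2⟩, -⟩ := hD
    exact hr.eq h1 ▸ h2
  have hDlow := hD.isLowerIn hB
  have hDB := hD.2.1
  set D' : Set α := {σ ∈ D | σ ∈ B₂ ∧ σ ∈ E ∧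
    ∀ ν ∈ T, ν ∉ maxIn T → ν ∈ E → ν ≤ σ → σ ∈ G ν} with hD'
  have hD'D : D' ⊆ D := fun _ h => h.1
  have hlow : IsLowerIn D D' := by
    rintro σ ⟨h1, h2, h3, h4⟩ τ hτ hle
    refine ⟨hτ, hB₂.isLowerIn hB σ h2 τ (hDB hτ) hle, hE.isLowerIn hB σ h3 τ (hDB hτ) hle, ?_⟩
    intro ν hν hνm hνE hντ
    exact (hGsb ν hν hνm hνE).isLowerIn hB σ (h4 ν hν hνm hνE (hντ.trans hle)) τ (hDB hτ) hle
  have hsb : sb M D D' := by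
    refine sb_of_isLowerIn hD.1 hD'D hrD ⟨hrD.1, hrsb _ hB₂, hrsb _ hE, ?_⟩ hlow ?_
    · exact fun ν hν hνm hνE _ => hrsb _ (hGsb ν hν hνm hνE)
    · rintro ν ⟨h1, h2, h3, h4⟩
      have hfin : {μ ∈ B | μ ≤ ν ∧ μ ∈ T ∧ μ ∉ maxIn T ∧ μ ∈ E}.Finite :=
        (hB.finite_below (hDB h1)).subset fun _ h => ⟨h.1, h.2.1⟩
      refine (((hB₂.finite_diff_s16 h2).union (hE.finite_diff_s16 h3)).union
        (hfin.biUnion (t := fun μ => succIn B ν \ G μ) ?_)).subset ?_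
      · rintro μ ⟨-, h5, h6, h7, h8⟩
        exact (hGsb μ h6 h7 h8).finite_diff_s16 (h4 μ h6 h7 h8 h5)
      · rintro ϱ ⟨hϱ, hϱ'⟩
        rw [hDlow.succIn_eq hDB] at hϱ
        by_contra hcon
        simp only [mem_union, mem_iUnion, not_or, not_exists] at hcon
        obtain ⟨⟨hc1, hc2⟩, hc3⟩ := hcon
        refine hϱ' ⟨hϱ.2, ?_, ?_, ?_⟩
        · by_contra h
          exact hc1 ⟨hϱ.1, h⟩
        · by_contra h
          exact hc2 ⟨hϱ.1, h⟩
        · intro μ hμT hμm hμE hμϱ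
          rcases hμϱ.eq_or_lt with rfl | hlt
          · exact hGmem μ hμT hμm hμE
          · by_contra h
            exact hc3 μ ⟨hTB hμT, hB.le_of_lt_succIn (hDB h1) (hTB hμT) hϱ.1 hlt,
              hμT, hμm, hμE⟩ ⟨hϱ.1, h⟩
  refine ⟨D', hsb, fun _ h => h.2.1, fun ν hνT hνm hν σ hσ hlt => ?_⟩
  have hσG := hσ.1.2.2.2 ν hνT hνm hν.2.2.1 hlt.le
  have hσB : σ ∈ maxIn B := hD.maxIn_subset_s16 (hsb.maxIn_subset_s16 hD.1 hσ)
  refine hG ν hνT hνm hν.2.2.1 σ ⟨hσG, fun τ hτ => hσB.2 τ ?_⟩ hlt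
  exact (hGsb ν hνT hνm hν.2.2.1).2.1 hτ

/-- If the successors in `T` of each node of `T` form a front of `D` above that node, then almost
fronts of `T` are almost fronts of `D`. -/
theorem IsAlmostFront.of_succIn_le (hD : CWT M D) (hr : IsRoot D r) (hrT : IsRoot T r)
    (hTD : T ⊆ D)
    (hs : ∀ ν ∈ T, ν ∉ maxIn T → ∀ σ ∈ maxIn D, ν < σ → ∃ η ∈ succIn T ν, η ≤ σ)
    {Y : Set α} (hY : IsAlmostFront M T Y) : IsAlmostFront M D Y := by
  obtain ⟨hYM, hanti, S, hS, hfront⟩ := hY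
  have hST := hS.2.1
  have hrS : r ∈ S := by
    obtain ⟨-, -, ⟨r', h1, h2⟩, -⟩ := hS
    exact hrT.eq h1 ▸ h2.1
  set S' : Set α := {σ ∈ D | ∀ ν ∈ S, ∀ τ ∈ succIn T ν, τ ∉ S → ¬τ ≤ σ} with hS'
  have hS'D : S' ⊆ D := fun _ h => h.1
  have hlow : IsLowerIn D S' := fun σ hσ τ hτ hle =>
    ⟨hτ, fun ν hν τ' hτ' hτS h => hσ.2 ν hν τ' hτ' hτS (h.trans hle)⟩
  have hsb : sb M D S' := by
    refine sb_of_isLowerIn hD hS'D hr ⟨hr.1, ?_⟩ hlow ?_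
    · intro ν hν τ hτ hτS h
      exact hτS (le_antisymm h (hr.2 τ (hTD hτ.1)) ▸ hrS)
    · rintro ν ⟨hν, hν'⟩
      have hfin : {μ ∈ D | μ ≤ ν ∧ μ ∈ S}.Finite :=
        (hD.finite_below hν).subset fun _ h => ⟨h.1, h.2.1⟩
      refine (hfin.biUnion (t := fun μ => succIn T μ \ S) ?_).subset ?_
      · exact fun μ hμ => hS.finite_diff_s16 hμ.2.2
      · rintro ϱ ⟨hϱ, hϱ'⟩
        by_contra hcon
        simp only [mem_iUnion, not_exists] at hcon
        refine hϱ' ⟨hϱ.1, fun μ hμ τ hτ hτS hle => ?_⟩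
        rcases hle.eq_or_lt with rfl | hlt
        · exact hcon μ ⟨hTD (hST hμ), hD.le_of_lt_succIn hν (hTD (hST hμ)) hϱ hτ.2.1, hμ⟩
            ⟨hτ, hτS⟩
        · exact hν' μ hμ τ hτ hτS (hD.le_of_lt_succIn hν (hTD hτ.1) hϱ hlt)
  refine ⟨hYM, hanti, S', hsb, inter_subset_right, fun η hη ν hν => hanti η hη.1 ν hν.1, ?_⟩
  intro σ hσ
  obtain ⟨σ', hσ', hle⟩ := hsb.1.exists_le_maxIn hσ
  have hσD := hsb.maxIn_subset_s16 hD hσ'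
  obtain ⟨μ, hμ⟩ := ((hD.finite_below hσD.1).subset
    (t := {μ ∈ S | μ ≤ σ'}) fun x hx => ⟨hTD (hST hx.1), hx.2⟩).exists_maximal
      ⟨r, hrS, hr.2 _ hσD.1⟩
  have hμm : μ ∈ maxIn S := by
    by_contra hn
    obtain ⟨τ, hτ, hμτ⟩ := exists_lt_of_notMem_maxIn hn hμ.1.1
    have hnT : μ ∉ maxIn T := fun h => h.2 τ (hST hτ) hμτ
    have hlt : μ < σ' := lt_of_le_of_ne hμ.1.2 fun h => hσD.2 τ (hTD (hST hτ)) (h ▸ hμτ)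
    obtain ⟨η, hη, hησ⟩ := hs μ (hST hμ.1.1) hnT σ' hσD hlt
    by_cases hηS : η ∈ S
    · exact absurd (hμ.2 ⟨hηS, hησ⟩ hη.2.1.le) hη.2.1.not_ge
    · exact hσ'.1.2 μ hμ.1.1 η hη hηS hησ
  obtain ⟨η, ⟨hηY, hηS⟩, hη⟩ := hfront.2.2 μ hμ.1.1
  have hημ : η ≤ μ := by
    rcases hη with h | h
    · exact h
    · rcases h.eq_or_lt with h | h
      · exact h.ge
      · exact absurd h (hμm.2 η hηS)
  have hησ' := hημ.trans hμ.1.2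
  have hηD := hTD (hST hηS)
  exact ⟨η, ⟨hηY, hlow σ' hσ'.1 η hηD hησ'⟩, hD.comparable hσD.1 hηD hσ.1 hησ' hle⟩

/-- The relation `≤*` is preserved when its right-hand side is replaced by a positive subtree. -/
theorem leStar.of_psb (h : leStar M B₁ B) (hD : psb M B D) : leStar M B₁ D := by
  obtain ⟨hB₁, hB, ⟨r, hr₁, hr⟩, B₂, hB₂, hTpsb, hfront⟩ := h
  set T := B₂ ∩ B₁ with hTdef
  have hT := hTpsb.1
  have hTB₁ : T ⊆ B₁ := inter_subset_right
  have hTB : T ⊆ B := inter_subset_left.trans hB₂.2.1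
  have hrD : IsRoot D r := by
    obtain ⟨-, -, ⟨r', h1, h2⟩, -⟩ := hD
    exact hr.eq h1 ▸ h2
  have hrT : IsRoot T r := by
    obtain ⟨-, -, ⟨r', h1, h2⟩, -⟩ := hTpsb
    exact hr₁.eq h1 ▸ h2
  have hDB := hD.2.1
  have hDlow := hD.isLowerIn hB
  have hTlow := hTpsb.isLowerIn hB₁
  obtain ⟨D', hD', hD'B₂, hs⟩ := exists_sb_succIn_le hB hT hTB (fun Y hY => (hfront Y hY)) hB₂ hD
  have hD'low := hD'.isLowerIn hD.1
  have hD'B : D' ⊆ B := hD'.2.1.trans hDB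
  have hrD' : IsRoot D' r := by
    obtain ⟨-, -, ⟨r', h1, h2⟩, -⟩ := hD'
    exact hrD.eq h1 ▸ h2
  have hlowB : IsLowerIn B D' := fun σ hσ τ hτ hle =>
    hD'low σ hσ τ (hDlow σ (hD'.2.1 hσ) τ hτ hle) hle
  set T' := D' ∩ B₁ with hT'def
  have hT'T : T' ⊆ T := fun σ hσ => ⟨hD'B₂ hσ.1, hσ.2⟩
  have hT'low : IsLowerIn B₁ T' := fun σ hσ τ hτ hle =>
    ⟨hlowB σ hσ.1 τ (hTB (hTlow σ (hT'T hσ) τ hτ hle)) hle, hτ⟩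
  have hs' : ∀ ν ∈ T', ν ∉ maxIn B₁ → ∀ σ ∈ maxIn D', ν < σ →
      ∃ η ∈ succIn B₁ ν ∩ T', η ≤ σ := by
    intro ν hν hνm σ hσ hlt
    obtain ⟨η, hη, hησ⟩ := hs ν (hT'T hν) (fun h => hνm (hTpsb.maxIn_subset_s16 h)) hν.1 σ hσ hlt
    rw [hTlow.succIn_eq hTB₁] at hη
    exact ⟨η, ⟨hη.1, hlowB σ hσ.1 η (hTB hη.2) hησ, hη.1.1⟩, hησ⟩
  have hT'psb : psb M B₁ T' := by
    refine psb_of_isLowerIn hB₁ inter_subset_right hr₁ ⟨hrD'.1, hr₁.1⟩ hT'low ?_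
    intro ν hν hνm F hF
    have hνm' : ν ∉ maxIn D' := by
      intro h
      obtain ⟨τ, hτ⟩ := (hTpsb.2.2.2 ν ⟨hT'T hν, hνm⟩).1.nonempty
      exact (hD.maxIn_subset_s16 (hD'.maxIn_subset_s16 hD.1 h)).2 τ (hTB hτ.1) hτ.2.1
    have hex : ∀ ϱ ∈ succIn D' ν, ∃ η ∈ succIn B₁ ν ∩ T', ϱ ≤ η := by
      intro ϱ hϱ
      obtain ⟨σ, hσ, hϱσ⟩ := hD'.1.exists_le_maxIn hϱ.1
      obtain ⟨η, hη, hησ⟩ := hs' ν hν hνm σ hσ (hϱ.2.1.trans_le hϱσ)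
      refine ⟨η, hη, ?_⟩
      rcases hD'.1.comparable hσ.1 hϱ.1 hη.2.1 hϱσ hησ with h | h
      · exact h
      · rcases h.eq_or_lt with h | h
        · exact h.ge
        · exact absurd ⟨η, hη.2.1, hη.1.2.1, h⟩ hϱ.2.2
    choose! f hf hle using hex
    refine Set.infinite_of_injOn_mapsTo (f := f) ?_ ?_ (hD'.1.nonmax_avoid hν.1 hνm' F hF)
    · intro ϱ hϱ ϱ' hϱ' heq
      have h1 := hle ϱ hϱ.1
      have h2 := hle ϱ' hϱ'.1
      rw [← heq] at h2
      rcases hD'.1.comparable (hf ϱ hϱ.1).2.1 hϱ.1.1 hϱ'.1.1 h1 h2 with h | h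
      · exact succIn_eq_of_le_of_le hϱ.1 hϱ'.1 h
      · exact (succIn_eq_of_le_of_le hϱ'.1 hϱ.1 h).symm
    · exact fun ϱ hϱ => ⟨hf ϱ hϱ.1, fun ρ hρ hc => hϱ.2 ρ hρ (hc.mono_right (hle ϱ hϱ.1))⟩
  refine ⟨hB₁, hD.1, ⟨r, hr₁, hrD⟩, D', hD', hT'psb, fun Y hY => .of_sb hD' ?_⟩
  refine IsAlmostFront.of_succIn_le (T := T') hD'.1 hrD' ⟨⟨hrD'.1, hr₁.1⟩, fun x hx => hr₁.2 x hx.2⟩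
    (fun σ hσ => hσ.1) (fun ν hν hνm σ hσ hlt => ?_) hY
  rw [hT'low.succIn_eq inter_subset_right]
  refine hs' ν hν (fun h => hνm ⟨hν, fun τ hτ => h.2 τ hτ.2⟩) σ hσ hlt

end Transfer

/-- An infinite set has an infinite subset outside a given countable family of sets. -/
theorem Set.Infinite.exists_infinite_subset_notMem {C : Set α} (hC : C.Infinite)
    {S : Set (Set α)} (hS : S.Countable) : ∃ A ⊆ C, A.Infinite ∧ A ∉ S := by
  obtain ⟨e, he, heC⟩ : ∃ e : ℕ → α, Function.Injective e ∧ ∀ n, e n ∈ C :=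
    ⟨fun n => hC.natEmbedding C n, fun a b h => (hC.natEmbedding C).injective (Subtype.ext h),
      fun n => (hC.natEmbedding C n).2⟩
  by_contra hcon
  push Not at hcon
  let f : Set ℕ → Set α := fun A => e '' ({n | Even n} ∪ {n | ∃ m ∈ A, n = 2 * m + 1})
  have hf : Function.Injective f := by
    intro A A' h
    have h' := he.image_injective h
    ext m
    have h1 := Set.ext_iff.1 h' (2 * m + 1)
    have h2 : ¬Even (2 * m + 1) := by simp
    simpa [h2] using h1
  have hmem : ∀ A, f A ∈ S := by
    intro A
    refine hcon _ ?_ (Set.Infinite.image he.injOn (Set.Infinite.mono subset_union_left ?_))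
    · rintro _ ⟨n, -, rfl⟩
      exact heC n
    · exact Set.infinite_of_injective_forall_mem (f := fun n : ℕ => 2 * n)
        (fun a b h => by simpa using h) (fun n => by simp)
  have : Countable S := hS
  have hcount : Countable (Set ℕ) :=
    Function.Injective.countable (f := fun A => (⟨f A, hmem A⟩ : S)) fun A A' h =>
      hf (congrArg Subtype.val h)
  obtain ⟨g, hg⟩ := exists_surjective_nat (Set ℕ)
  exact Function.cantor_surjective g hg

section Thin

variable [PartialOrder α] {M B : Set α} {r : α}

/-- In a countable partial order, each non-maximal node `ν` of a tree has an infinite set of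
successors of which each `ρ ≰ ν` is compatible with only finitely many. -/
theorem CWT.exists_thin_succIn (hB : CWT M B) (hM : M.Countable) {ν : α} (hν : ν ∈ B)
    (hm : ν ∉ maxIn B) : ∃ C ⊆ succIn B ν, C.Infinite ∧
      ∀ ρ ∈ M, ¬ρ ≤ ν → {ϱ ∈ C | Compat M ρ ϱ}.Finite := by
  classical
  have hcount : (M \ {ρ | ρ ≤ ν}).Countable := hM.mono sdiff_subset
  obtain ⟨τ, hτ, hlt⟩ := exists_lt_of_notMem_maxIn hm hν
  obtain ⟨e, he⟩ := hcount.exists_eq_range ⟨τ, hB.subset hτ, hlt.not_ge⟩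
  have hex : ∀ n : ℕ, ∃ ϱ ∈ succIn B ν, ∀ k ≤ n, ¬Compat M (e k) ϱ := by
    intro n
    obtain ⟨ϱ, h1, h2⟩ := (hB.nonmax_avoid hν hm ((Finset.range (n + 1)).image e) (by
      rw [he]
      intro x hx
      simp only [Finset.coe_image, Set.mem_image] at hx
      obtain ⟨k, -, rfl⟩ := hx
      exact ⟨k, rfl⟩)).nonempty
    exact ⟨ϱ, h1, fun k hk => h2 _ (Finset.mem_image_of_mem e (Finset.mem_range.2 (by omega)))⟩
  choose f hf hfe using hex
  have hthin : ∀ ρ ∈ M, ¬ρ ≤ ν → ∃ k, ∀ n, Compat M ρ (f n) → n < k := by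
    intro ρ hρ hρν
    obtain ⟨k, rfl⟩ : ρ ∈ range e := he ▸ ⟨hρ, hρν⟩
    refine ⟨k, fun n hc => ?_⟩
    by_contra hn
    exact hfe n k (not_lt.1 hn) hc
  have hfin : ∀ ρ ∈ M, ¬ρ ≤ ν → {ϱ ∈ range f | Compat M ρ ϱ}.Finite := by
    intro ρ hρ hρν
    obtain ⟨k, hk⟩ := hthin ρ hρ hρν
    refine ((Set.finite_lt_nat k).image f).subset ?_
    rintro _ ⟨⟨n, rfl⟩, hc⟩
    exact ⟨n, hk n hc, rfl⟩
  refine ⟨range f, by rintro _ ⟨n, rfl⟩; exact hf n, fun hfinite => ?_, hfin⟩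
  have hall : ∀ ϱ ∈ range f, ∃ k, ∀ n, ϱ = f n → n < k := by
    rintro _ ⟨m, rfl⟩
    have hmM := hB.subset (hf m).1
    obtain ⟨k, hk⟩ := hthin (f m) hmM (hf m).2.1.not_ge
    exact ⟨k, fun n hn => hk n ⟨f m, hmM, le_rfl, hn.ge⟩⟩
  choose! g hg using hall
  obtain ⟨N, hN⟩ := (hfinite.image g).bddAbove
  have h1 := hg (f N) ⟨N, rfl⟩ N rfl
  exact h1.not_ge (hN ⟨f N, ⟨N, rfl⟩, rfl⟩)

/-- A tree which is not a singleton has a positive subtree, outside a given countable family,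
in which each `ρ ≰ ν` is compatible with only finitely many successors of a node `ν`. -/
theorem CWT.exists_thin_psb (hB : CWT M B) (hM : M.Countable) (hr : IsRoot B r)
    (hrm : r ∉ maxIn B) {S : Set (Set α)} (hS : S.Countable) :
    ∃ D, psb M B D ∧ D ∉ S ∧
      ∀ ν ∈ D, ν ∉ maxIn D → ∀ ρ ∈ M, ¬ρ ≤ ν → {ϱ ∈ succIn D ν | Compat M ρ ϱ}.Finite := by
  obtain ⟨c, hcsub, hcinf, hcthin, hcS⟩ : ∃ c : α → Set α, (∀ ν, c ν ⊆ succIn B ν) ∧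
      (∀ ν ∈ B, ν ∉ maxIn B → (c ν).Infinite) ∧
      (∀ ν ∈ B, ν ∉ maxIn B → ∀ ρ ∈ M, ¬ρ ≤ ν → {ϱ ∈ c ν | Compat M ρ ϱ}.Finite) ∧
      c r ∉ (fun X => succIn B r ∩ X) '' S := by
    have hex : ∀ ν, ∃ C ⊆ succIn B ν, (ν ∈ B → ν ∉ maxIn B → C.Infinite) ∧
        (ν ∈ B → ν ∉ maxIn B → ∀ ρ ∈ M, ¬ρ ≤ ν → {ϱ ∈ C | Compat M ρ ϱ}.Finite) ∧
        (ν = r → C ∉ (fun X => succIn B r ∩ X) '' S) := by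
      intro ν
      by_cases h : ν ∈ B ∧ ν ∉ maxIn B
      · obtain ⟨C, h1, h2, h3⟩ := hB.exists_thin_succIn hM h.1 h.2
        obtain ⟨A, hA, hAinf, hAS⟩ := h2.exists_infinite_subset_notMem
          (hS.image (fun X => succIn B r ∩ X))
        exact ⟨A, hA.trans h1, fun _ _ => hAinf, fun _ _ ρ hρ hρν =>
          (h3 ρ hρ hρν).subset fun _ hx => ⟨hA hx.1, hx.2⟩, fun _ => hAS⟩
      · exact ⟨∅, empty_subset _, fun h1 h2 => absurd ⟨h1, h2⟩ h,
          fun h1 h2 => absurd ⟨h1, h2⟩ h, fun h1 => absurd ⟨h1 ▸ hr.1, h1 ▸ hrm⟩ h⟩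
    choose c h1 h2 h3 h4 using hex
    exact ⟨c, h1, h2, h3, h4 r rfl⟩
  set D : Set α := {σ ∈ B | ∀ ν ∈ B, ∀ τ ∈ succIn B ν, τ ≤ σ → τ ∈ c ν} with hDdef
  have hDB : D ⊆ B := fun _ h => h.1
  have hrD : r ∈ D := ⟨hr.1, fun ν hν τ hτ hle =>
    absurd hle (((hr.2 ν hν).trans_lt hτ.2.1).not_ge)⟩
  have hlow : IsLowerIn B D := fun σ hσ τ hτ hle =>
    ⟨hτ, fun ν hν τ' hτ' h => hσ.2 ν hν τ' hτ' (h.trans hle)⟩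
  have hsucc : ∀ ν ∈ D, succIn B ν ∩ D = c ν := by
    intro ν hν
    apply Subset.antisymm
    · rintro ϱ ⟨h1, h2⟩
      exact h2.2 ν hν.1 ϱ h1 le_rfl
    · intro ϱ hϱ
      have hϱs := hcsub ν hϱ
      refine ⟨hϱs, hϱs.1, fun μ hμ τ hτ hle => ?_⟩
      rcases hle.eq_or_lt with rfl | hlt
      · rwa [le_antisymm (hB.le_of_lt_succIn hν.1 hμ hϱs hτ.2.1)
          (hB.le_of_lt_succIn hμ hν.1 hτ hϱs.2.1)]
      · exact hν.2 μ hμ τ hτ (hB.le_of_lt_succIn hν.1 hτ.1 hϱs hlt)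
  have hpsb : psb M B D := by
    refine psb_of_isLowerIn hB hDB hr hrD hlow fun ν hν hm F hF => ?_
    rw [hsucc ν hν]
    have hfin : (⋃ ρ ∈ (F : Set α), {ϱ ∈ c ν | Compat M ρ ϱ}).Finite :=
      F.finite_toSet.biUnion fun ρ hρ => hcthin ν hν.1 hm ρ (hF hρ).1 (hF hρ).2
    refine ((hcinf ν hν.1 hm).sdiff hfin).mono ?_
    rintro ϱ ⟨h1, h2⟩
    exact ⟨h1, fun ρ hρ hc => h2 (mem_biUnion (Finset.mem_coe.2 hρ) ⟨h1, hc⟩)⟩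
  refine ⟨D, hpsb, fun hDS => hcS ⟨D, hDS, hsucc r hrD⟩, fun ν hν hm ρ hρ hρν => ?_⟩
  rw [hlow.succIn_eq hDB, hsucc ν hν]
  exact hcthin ν hν.1 (fun h => hm ⟨hν, fun τ hτ => h.2 τ (hDB hτ)⟩) ρ hρ hρν

end Thin

namespace KSys

variable [PartialOrder α] (x : KSys α)

theorem norm_le_aleph0_iff :
    x.norm ≤ ℵ₀ ↔ x.M.Countable ∧ ∀ η ∈ x.M, (x.A η).Countable := by
  rw [norm, ← Cardinal.mk_sigma]
  constructor
  · intro h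
    have h1 : x.M.Countable := Cardinal.le_aleph0_iff_set_countable.1 (le_self_add.trans h)
    have h2 := Cardinal.mk_le_aleph0_iff.1 (le_add_self.trans h)
    refine ⟨h1, fun η hη => ?_⟩
    have hinj : Function.Injective (fun a : x.A η =>
        (⟨⟨η, hη⟩, a⟩ : Σ η : x.M, x.A (η : α))) := fun a b h => by simpa using h
    exact hinj.countable
  · rintro ⟨h1, h2⟩
    have : Countable x.M := h1
    have : ∀ η : x.M, Countable (x.A (η : α)) := fun η => h2 η η.2
    exact Cardinal.add_le_aleph0.2 ⟨Cardinal.mk_le_aleph0, Cardinal.mk_le_aleph0⟩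

/-- Adjoin to `x` a new tree `D`, together with its cones, as the greatest element. -/
def adjoinTop (D : Set α) (hD : CWT x.M D) (hr : IsRoot D x.rt) (hDx : D ∉ x.A x.rt)
    (hne : D ≠ {x.rt}) (hle : ∀ X ∈ x.Bf, leStar x.M X D) : KSys α where
  M := x.M
  rt := x.rt
  rt_mem := x.rt_mem
  rt_least := x.rt_least
  A η := x.A η ∪ {X | η ∈ D ∧ X = D ∩ {ρ | η ≤ ρ}}
  A_empty η hη := by
    rw [x.A_empty η hη, empty_union, Set.eq_empty_iff_forall_notMem]
    exact fun X hX => hη (hD.subset hX.1)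
  A_cwt η hη X := by
    rintro (h | ⟨h, rfl⟩)
    · exact x.A_cwt η hη X h
    · exact hD.cone h
  A_root η hη X := by
    rintro (h | ⟨h, rfl⟩)
    · exact x.A_root η hη X h
    · exact ⟨⟨h, le_rfl⟩, fun _ hx => hx.2⟩
  A_singleton η hη := Or.inl (x.A_singleton η hη)
  lex X Z := x.lex X Z ∨ (X ∈ x.Bf ∨ X = D) ∧ Z = D
  lex_mem := by
    have hD' : D ∈ (x.A x.rt ∪ {X | x.rt ∈ D ∧ X = D ∩ {ρ | x.rt ≤ ρ}}) \ {{x.rt}} :=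
      ⟨Or.inr ⟨hr.1, (inter_eq_left.2 hr.2).symm⟩, hne⟩
    have hx : ∀ X ∈ x.Bf, X ∈ (x.A x.rt ∪ {X | x.rt ∈ D ∧ X = D ∩ {ρ | x.rt ≤ ρ}}) \ {{x.rt}} :=
      fun X hX => ⟨Or.inl hX.1, hX.2⟩
    rintro X Z (h | ⟨h | rfl, rfl⟩)
    · exact ⟨hx X (x.lex_mem X Z h).1, hx Z (x.lex_mem X Z h).2⟩
    · exact ⟨hx X h, hD'⟩
    · exact ⟨hD', hD'⟩
  lex_refl := by
    rintro X ⟨h | ⟨-, rfl⟩, hX⟩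
    · exact Or.inl (x.lex_refl X ⟨h, hX⟩)
    · rw [inter_eq_left.2 (show D ⊆ {ρ | x.rt ≤ ρ} from hr.2)]
      exact Or.inr ⟨Or.inr rfl, rfl⟩
  lex_trans := by
    rintro X Z W (h | ⟨h, rfl⟩) (h' | ⟨h', rfl⟩)
    · exact Or.inl (x.lex_trans X Z W h h')
    · exact Or.inr ⟨Or.inl (x.lex_mem X Z h).1, rfl⟩
    · exact absurd (x.lex_mem _ _ h').1.1 hDx
    · exact Or.inr ⟨h, rfl⟩
  lex_antisymm := by
    rintro X Z (h | ⟨h, rfl⟩) (h' | ⟨h', rfl⟩)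
    · exact x.lex_antisymm X Z h h'
    · exact absurd (x.lex_mem _ _ h).1.1 hDx
    · exact absurd (x.lex_mem _ _ h').1.1 hDx
    · rfl
  lex_directed := by
    have hmem : ∀ X ∈ (x.A x.rt ∪ {X | x.rt ∈ D ∧ X = D ∩ {ρ | x.rt ≤ ρ}}) \ {{x.rt}},
        X ∈ x.Bf ∨ X = D := by
      rintro X ⟨h | ⟨-, rfl⟩, hX⟩
      · exact Or.inl ⟨h, hX⟩
      · exact Or.inr (inter_eq_left.2 hr.2)
    exact fun X hX Z hZ => ⟨D, ⟨Or.inr ⟨hr.1, (inter_eq_left.2 hr.2).symm⟩, hne⟩,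
      Or.inr ⟨hmem X hX, rfl⟩, Or.inr ⟨hmem Z hZ, rfl⟩⟩
  lex_leStar := by
    rintro X Z (h | ⟨h | rfl, rfl⟩)
    · exact x.lex_leStar X Z h
    · exact hle X h
    · exact leStar_refl hD
  A_restrict η hη := by
    rintro X (h | ⟨-, rfl⟩) ν hν
    · exact Or.inl (x.A_restrict η hη X h ν hν)
    · refine Or.inr ⟨hν.1, ?_⟩
      ext ρ
      exact ⟨fun h => ⟨h.1.1, h.2⟩, fun h => ⟨⟨h.1, le_trans hν.2 h.2⟩, h.2⟩⟩

end KSys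

/-- if `x ∈ 𝐊_{≤ℵ₀}` and `B ∈ ℬ_x` is `≤_x`-maximal, then there are
`y ∈ 𝐊_{≤ℵ₀}` and `B' ∈ ℬ_y` such that `x ≤_𝐊 y` with `M_x = M_y`, `B'` is
`≤_y`-maximal, and for every `ν ∈ B' \ max(B')` and `ρ ∈ M` with `ρ ≰ ν`, all but
finitely many `ϱ ∈ suc_{B'}(ν)` are incompatible with `ρ`. -/
theorem exists_extension_with_thin_max [PartialOrder α] (x : KSys α)
    (hx : x.norm ≤ Cardinal.aleph0) (B : Set α) (hB : B ∈ x.Bf)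
    (hmax : ∀ B' ∈ x.Bf, x.lex B B' → B' = B) :
    ∃ (y : KSys α) (B' : Set α), B' ∈ y.Bf ∧
      y.norm ≤ Cardinal.aleph0 ∧ KLE x y ∧ y.M = x.M ∧
      (∀ B'' ∈ y.Bf, y.lex B' B'' → B'' = B') ∧
      (∀ ν ∈ B' \ maxIn B', ∀ ρ ∈ y.M, ¬ρ ≤ ν →
        {ϱ ∈ succIn B' ν | Compat y.M ρ ϱ}.Finite) := by
  obtain ⟨hM, hA⟩ := x.norm_le_aleph0_iff.1 hx
  have hBcwt := x.A_cwt _ x.rt_mem B hB.1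
  have hr := x.A_root _ x.rt_mem B hB.1
  have hrm : x.rt ∉ maxIn B := by
    intro h
    refine hB.2 (Subset.antisymm (fun σ hσ => ?_) (singleton_subset_iff.2 hr.1))
    by_contra hne
    exact h.2 σ hσ (lt_of_le_of_ne (hr.2 σ hσ) fun h => hne h.symm)
  obtain ⟨D, hD, hDx, hthin⟩ := hBcwt.exists_thin_psb hM hr hrm (hA _ x.rt_mem)
  have hrD : IsRoot D x.rt := by
    obtain ⟨-, -, ⟨r, h1, h2⟩, -⟩ := hD
    exact hr.eq h1 ▸ h2
  have hne : D ≠ {x.rt} := fun h => hDx (h ▸ x.A_singleton _ x.rt_mem)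
  have hle : ∀ X ∈ x.Bf, leStar x.M X D := by
    intro X hX
    obtain ⟨Z, hZ, hXZ, hBZ⟩ := x.lex_directed X hX B hB
    obtain rfl := hmax Z hZ hBZ
    exact (x.lex_leStar X Z hXZ).of_psb hD
  refine ⟨x.adjoinTop D hD.1 hrD hDx hne hle, D, ?_, ?_, ?_, rfl, ?_, ?_⟩
  · exact ⟨Or.inr ⟨hrD.1, (inter_eq_left.2 hrD.2).symm⟩, hne⟩
  · refine (KSys.norm_le_aleph0_iff _).2 ⟨hM, fun η hη => (hA η hη).union ?_⟩
    exact (countable_singleton (D ∩ {ρ | η ≤ ρ})).mono fun _ h => h.2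
  · refine ⟨subset_rfl, fun _ _ _ _ => Iff.rfl, fun _ _ => subset_union_left, rfl, ?_⟩
    refine fun X _ Z hZ => ⟨Or.inl, ?_⟩
    rintro (h | ⟨-, rfl⟩)
    · exact h
    · exact absurd hZ.1 hDx
  · rintro Z - (h | h)
    · exact absurd (x.lex_mem _ _ h).1.1 hDx
    · exact h.2
  · exact fun ν hν ρ hρ hρν => hthin ν hν.1 hν.2 ρ hρ hρν
end
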